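/- arXiv:math/0201201 — 14 statements merged into one kernel-verified Lean document; each statement's English description precedes it below -/
import Mathlib

section
/- Let k be a finitely generated commutative ℂ-algebra, let A be a unital finite type k-algebra, and let Z denote the center of A. Then for every primitive ideal P of A: (i) P ∩ Z is a maximal ideal of Z; (ii) there is a ℂ-algebra isomorphism A/P ≅ M_n(ℂ) for some n ≥ 1; and (iii) if A is generated by q elements as a Z-module, then n² ≤ q. -/
/-- A primitive ideal of a unital ring `A`: a (two-sided) ideal which is the
annihilator of a simple left `A`-module. -/
def IsPrimitiveIdeal (A : Type) [Ring A] (P : Ideal A) : Prop :=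
  ∃ (V : Type) (_ : AddCommGroup V) (_ : Module A V),
    IsSimpleModule A V ∧ P = Module.annihilator A V

/-- The primitive ideal spectrum of a unital ring. -/
def PrimSpec (A : Type) [Ring A] : Type := {P : Ideal A // IsPrimitiveIdeal A P}

/-- The Jacobson radical: the intersection of all primitive ideals. -/
def jacRad (A : Type) [Ring A] : Ideal A := sInf {P : Ideal A | IsPrimitiveIdeal A P}

section SpectrumPreservingDefs
variable {k L J : Type} [CommRing k] [Ring L] [Ring J] [Algebra k L] [Algebra k J]

/-- `f` realizes the relation `R_φ = {(P', P) : φ⁻¹(P') ⊆ P}` as the graph of a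
bijection `Prim(J) → Prim(L)`. -/
def IsGraphOf (φ : L →ₙₐ[k] J) (f : PrimSpec J → PrimSpec L) : Prop :=
  Function.Bijective f ∧
    ∀ (P : PrimSpec J) (Q : PrimSpec L),
      ((⇑φ) ⁻¹' (P.1 : Set J) ⊆ (Q.1 : Set L)) ↔ f P = Q

/-- A `k`-linear (not necessarily unital) algebra morphism of unital `k`-algebras is
spectrum preserving iff `R_φ` is the graph of a bijection `Prim(J) → Prim(L)`. -/
def SpectrumPreserving (φ : L →ₙₐ[k] J) : Prop := ∃ f, IsGraphOf φ f

end SpectrumPreservingDefs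

/-- If a simple `A`-module is finite over a commutative ring `k`, and `A` is a `k`-algebra, then
its annihilator in `k` is a maximal ideal. -/
lemma Module.annihilator_isMaximal_of_isSimpleModule
    (k A V : Type*) [CommRing k] [Ring A] [Algebra k A] [AddCommGroup V] [Module A V]
    [Module k V] [IsScalarTower k A V] [Module.Finite k V] [IsSimpleModule A V] :
    (Module.annihilator k V).IsMaximal := by
  have : Nontrivial V := IsSimpleModule.nontrivial A V
  refine Ideal.isMaximal_iff.2 ⟨fun h => ?_, fun J c hJ hc hcJ => ?_⟩
  · obtain ⟨v, hv⟩ := exists_ne (0 : V)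
    exact hv (by simpa using Module.mem_annihilator.1 h v)
  let φ : V →ₗ[A] V :=
    { toFun := fun v => c • v
      map_add' := smul_add c
      map_smul' := fun a v => by
        simp only [RingHom.id_apply]
        rw [← algebraMap_smul A c, ← algebraMap_smul A c v, ← mul_smul, ← mul_smul,
          Algebra.commutes] }
  have hφ : φ ≠ 0 := fun h => hc (Module.mem_annihilator.2 fun v => LinearMap.congr_fun h v)
  have hsurj : Function.Surjective φ := LinearMap.surjective_of_ne_zero hφ
  obtain ⟨r, hr, hrV⟩ := Submodule.exists_sub_one_mem_and_smul_eq_zero_of_fg_of_le_smul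
    (Ideal.span {c}) (⊤ : Submodule k V) Module.Finite.fg_top fun v _ => by
      obtain ⟨w, rfl⟩ := hsurj v
      exact Submodule.smul_mem_smul (Ideal.mem_span_singleton_self c) Submodule.mem_top
  have h1 : r - 1 ∈ J := (Ideal.span_singleton_le_iff_mem J).2 hcJ hr
  have h2 : r ∈ J := hJ (Module.mem_annihilator.2 fun v => hrV v Submodule.mem_top)
  simpa using J.sub_mem h2 h1

/-- A simple module over a finite algebra over a finitely generated commutative `F`-algebra is
finite-dimensional over the field `F`. -/
lemma IsSimpleModule.finite_of_finiteType
    (F k A V : Type*) [Field F] [CommRing k] [Algebra F k] [Algebra.FiniteType F k]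
    [Ring A] [Algebra k A] [Module.Finite k A] [AddCommGroup V] [Module A V]
    [Module k V] [IsScalarTower k A V] [Module F V] [IsScalarTower F k V] [IsSimpleModule A V] :
    Module.Finite F V := by
  have : Module.Finite k V := Module.Finite.trans A V
  have := Module.annihilator_isMaximal_of_isSimpleModule k A V
  let I := Module.annihilator k V
  let _ : Field (k ⧸ I) := Ideal.Quotient.field I
  have : Module.Finite F (k ⧸ I) := finite_of_finite_type_of_isJacobsonRing F (k ⧸ I)
  let _ : Module (k ⧸ I) V := Module.quotientAnnihilator
  have hmk (c : k) (v : V) : (Ideal.Quotient.mk I c) • v = c • v := rfl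
  have : IsScalarTower k (k ⧸ I) V := ⟨fun c d v => by
    obtain ⟨d, rfl⟩ := Ideal.Quotient.mk_surjective d
    rw [hmk, ← mul_smul]
    rfl⟩
  have : IsScalarTower F (k ⧸ I) V := ⟨fun c d v => by
    obtain ⟨d, rfl⟩ := Ideal.Quotient.mk_surjective d
    rw [hmk, ← smul_assoc]
    rfl⟩
  have : Module.Finite (k ⧸ I) V := Module.Finite.of_restrictScalars_finite k (k ⧸ I) V
  exact Module.Finite.trans (k ⧸ I) V

/-- Burnside's theorem: an algebra over an algebraically closed field surjects onto the
endomorphisms of any finite-dimensional simple module. -/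
lemma IsSimpleModule.lsmul_surjective_of_isAlgClosed
    (F A V : Type*) [Field F] [IsAlgClosed F] [Ring A] [Algebra F A] [AddCommGroup V]
    [Module A V] [Module F V] [IsScalarTower F A V] [Module.Finite F V] [IsSimpleModule A V] :
    Function.Surjective (Algebra.lsmul F F V : A →ₐ[F] Module.End F V) := by
  intro f
  let g : Module.End (Module.End A V) V :=
    { toFun := f
      map_add' := f.map_add
      map_smul' := fun e v => by
        obtain ⟨c, rfl⟩ := (IsSimpleModule.algebraMap_end_bijective_of_isAlgClosed F).2 e
        simp }
  obtain ⟨s, hs⟩ := Module.Finite.fg_top (R := F) (M := V)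
  obtain ⟨r, hr⟩ := jacobson_density g s
  exact ⟨r, LinearMap.ext_on hs fun v hv => (hr v hv).symm⟩

/-- A central element acts by a scalar on a finite-dimensional simple module over an algebra over
an algebraically closed field. -/
lemma IsSimpleModule.exists_smul_eq_of_mem_center
    (F : Type*) {A : Type*} (V : Type*) [Field F] [IsAlgClosed F] [Ring A] [Algebra F A]
    [AddCommGroup V] [Module A V] [Module F V] [IsScalarTower F A V] [Module.Finite F V]
    [IsSimpleModule A V] {z : A} (hz : z ∈ Subring.center A) :
    ∃ c : F, ∀ v : V, z • v = c • v := by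
  let φ : Module.End A V :=
    { toFun := fun v => z • v
      map_add' := smul_add z
      map_smul' := fun a v => by
        simp only [RingHom.id_apply]
        rw [← mul_smul, ← mul_smul, Subring.mem_center_iff.1 hz a] }
  obtain ⟨c, hc⟩ := (IsSimpleModule.algebraMap_end_bijective_of_isAlgClosed F).2 φ
  exact ⟨c, fun v => (LinearMap.congr_fun hc v).symm⟩

/-- Lemma (lemma.onto): for a unital finite type `k`-algebra `A` with center `Z`,
every primitive ideal `P` satisfies: `P ∩ Z` is maximal in `Z`, `A/P ≅ Mₙ(ℂ)` for some
`n ≥ 1` (phrased via a surjective `ℂ`-algebra map with kernel `P`), and if `A` is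
generated by `q` elements as a `Z`-module then `n² ≤ q`. -/
theorem primitive_ideal_center_maximal_and_matrix_quotient
    (k : Type) [CommRing k] [Algebra ℂ k] [Algebra.FiniteType ℂ k]
    (A : Type) [Ring A] [Algebra k A] [Module.Finite k A]
    [Algebra ℂ A] [IsScalarTower ℂ k A]
    (P : Ideal A) (hP : IsPrimitiveIdeal A P) :
    (P.comap (Subring.center A).subtype).IsMaximal ∧
    ∃ n : ℕ, 1 ≤ n ∧
      (∃ f : A →ₐ[ℂ] Matrix (Fin n) (Fin n) ℂ,
        Function.Surjective f ∧ RingHom.ker f = P) ∧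
      ∀ (q : ℕ) (s : Finset A), s.card = q →
        Submodule.span (Subring.center A) (s : Set A) = ⊤ → n ^ 2 ≤ q := by
  obtain ⟨V, _, _, _, rfl⟩ := hP
  let _ : Module k V := Module.compHom V (algebraMap k A)
  let _ : Module ℂ V := Module.compHom V (algebraMap ℂ A)
  have : IsScalarTower k A V := .of_algebraMap_smul fun _ _ => rfl
  have : IsScalarTower ℂ A V := .of_algebraMap_smul fun _ _ => rfl
  have : IsScalarTower ℂ k V := .of_algebraMap_smul fun c v => by
    rw [← algebraMap_smul A (algebraMap ℂ k c) v, ← IsScalarTower.algebraMap_apply,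
      algebraMap_smul]
  have : Module.Finite ℂ V := IsSimpleModule.finite_of_finiteType ℂ k A V
  have : Nontrivial V := IsSimpleModule.nontrivial A V
  have hsurj := IsSimpleModule.lsmul_surjective_of_isAlgClosed ℂ A V
  have hscalar (z : A) (hz : z ∈ Subring.center A) :
      ∃ c : ℂ, ∀ v : V, z • v = c • v := IsSimpleModule.exists_smul_eq_of_mem_center ℂ V hz
  refine ⟨Ideal.isMaximal_iff.2 ⟨fun h => ?_, fun J z hJ hz hzJ => ?_⟩,
    Module.finrank ℂ V, Module.finrank_pos, ?_, fun q s hq hs => ?_⟩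
  · obtain ⟨v, hv⟩ := exists_ne (0 : V)
    exact hv (by simpa using Module.mem_annihilator.1 h v)
  · obtain ⟨c, hc⟩ := hscalar z z.2
    have hc0 : c ≠ 0 := by
      rintro rfl
      exact hz (Module.mem_annihilator.2 fun v => (hc v).trans (zero_smul ℂ v))
    let w : Subring.center A :=
      ⟨algebraMap ℂ A c⁻¹, Subring.mem_center_iff.2 fun a => (Algebra.commutes c⁻¹ a).symm⟩
    have hw : 1 - w * z ∈ J := hJ <| Module.mem_annihilator.2 fun v => by
      change ((1 : A) - algebraMap ℂ A c⁻¹ * z) • v = 0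
      rw [sub_smul, mul_smul, hc, algebraMap_smul, inv_smul_smul₀ hc0, one_smul, sub_self]
    simpa using J.add_mem hw (J.mul_mem_left w hzJ)
  · let e := LinearMap.toMatrixAlgEquiv (Module.finBasis ℂ V)
    refine ⟨e.toAlgHom.comp (Algebra.lsmul ℂ ℂ V), e.surjective.comp hsurj, ?_⟩
    ext a
    rw [RingHom.mem_ker, Module.mem_annihilator]
    change e (Algebra.lsmul ℂ ℂ V a) = 0 ↔ _
    rw [EmbeddingLike.map_eq_zero_iff, LinearMap.ext_iff]
    rfl
  · classical
    let t : Finset (Module.End ℂ V) := s.image (Algebra.lsmul ℂ ℂ V)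
    have hmem (a : A) : Algebra.lsmul ℂ ℂ V a ∈ Submodule.span ℂ (t : Set (Module.End ℂ V)) := by
      induction hs.ge (Submodule.mem_top : a ∈ ⊤) using Submodule.span_induction with
      | mem a ha => exact Submodule.subset_span (Finset.mem_coe.2 (Finset.mem_image_of_mem _ ha))
      | zero => simp
      | add _ _ _ _ h₁ h₂ => simpa using add_mem h₁ h₂
      | smul z a _ h =>
        obtain ⟨c, hc⟩ := hscalar z z.2
        have : Algebra.lsmul ℂ ℂ V (z • a) = c • Algebra.lsmul ℂ ℂ V a := LinearMap.ext fun v => by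
          change ((z : A) * a) • v = c • a • v
          rw [mul_smul, hc]
        exact this ▸ Submodule.smul_mem _ c h
    have htop : Submodule.span ℂ (t : Set (Module.End ℂ V)) = ⊤ :=
      eq_top_iff.2 fun f _ => by
        obtain ⟨a, rfl⟩ := hsurj f
        exact hmem a
    calc Module.finrank ℂ V ^ 2 = Module.finrank ℂ (Module.End ℂ V) := by
          rw [Module.finrank_linearMap, sq]
      _ = Module.finrank ℂ (Submodule.span ℂ (t : Set (Module.End ℂ V))) := by
          rw [htop, finrank_top]
      _ ≤ t.card := finrank_span_finset_le_card t
      _ ≤ q := hq ▸ Finset.card_image_le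
end

section
/- Let A be a unital associative ℂ-algebra whose dimension as a ℂ-vector space is at most countable, and let V be a simple left A-module. Then every A-module endomorphism of V is given by multiplication by a complex scalar; that is, the natural map ℂ → End_A(V) is a bijection. -/
open Polynomial in
/-- If no nonzero polynomial in `f` kills `v`, then any family of preimages of `v` under the
maps `f - a` is linearly independent. -/
theorem linearIndependent_of_sub_algebraMap_apply_eq {K V : Type*} [Field K] [AddCommGroup V]
    [Module K V] {f : Module.End K V} {v : V} (hv : ∀ p : K[X], aeval f p v = 0 → p = 0)
    {w : K → V} (hw : ∀ a, (f - algebraMap K (Module.End K V) a) (w a) = v) :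
    LinearIndependent K w := by
  classical
  refine linearIndependent_iff'.2 fun s m hm i hi ↦ ?_
  have key : ∀ j ∈ s, aeval f (∏ a ∈ s, (X - C a)) (w j) =
      aeval f (∏ a ∈ s.erase j, (X - C a)) v := fun j hj ↦ by
    rw [← s.prod_erase_mul _ hj, map_mul, Module.End.mul_apply]
    simp only [map_sub, aeval_X, aeval_C, hw]
  have hp : ∑ j ∈ s, C (m j) * ∏ a ∈ s.erase j, (X - C a) = 0 := hv _ <| by
    have h0 := congrArg (aeval f (∏ a ∈ s, (X - C a))) hm
    rw [map_sum, map_zero] at h0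
    rw [← h0, map_sum, LinearMap.sum_apply]
    refine Finset.sum_congr rfl fun j hj ↦ ?_
    rw [map_smul, key j hj, map_mul, aeval_C, Module.End.mul_apply, Module.algebraMap_end_apply]
  have he := congrArg (eval i) hp
  rw [eval_finsetSum, eval_zero, Finset.sum_eq_single_of_mem i hi fun j hj hji ↦ ?_] at he
  · rw [eval_mul, eval_C, eval_prod] at he
    refine eq_zero_of_ne_zero_of_mul_right_eq_zero (Finset.prod_ne_zero_iff.2 fun a ha ↦ ?_) he
    simpa using sub_ne_zero.2 (Finset.ne_of_mem_erase ha).symm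
  · rw [eval_mul, eval_prod, Finset.prod_eq_zero (Finset.mem_erase.2 ⟨hji.symm, hi⟩) (by simp),
      mul_zero]

open Polynomial in
/-- An endomorphism of a nonzero vector space whose dimension is smaller than the cardinality of
the algebraically closed base field has nonempty spectrum. -/
theorem Module.End.spectrum_nonempty_of_rank_lt.{u, v} {K : Type u} {V : Type v}
    [Field K] [IsAlgClosed K] [AddCommGroup V] [Module K V] [Nontrivial V] (f : Module.End K V)
    (h : Cardinal.lift.{u} (Module.rank K V) < Cardinal.lift.{v} (Cardinal.mk K)) :
    (spectrum K f).Nonempty := by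
  by_contra hs
  rw [Set.not_nonempty_iff_eq_empty] at hs
  have hunit (p : K[X]) (hp : p ≠ 0) : IsUnit (aeval f p) := by
    rcases lt_or_ge 0 p.degree with hd | hd
    · have := spectrum.map_polynomial_aeval_of_degree_pos f p hd
      rw [hs, Set.image_empty] at this
      exact spectrum.zero_notMem_iff K |>.1 (this ▸ Set.notMem_empty 0)
    · rw [eq_C_of_degree_le_zero hd] at hp ⊢
      rw [aeval_C]
      exact (isUnit_iff_ne_zero.2 (C_ne_zero.1 hp)).map _
  obtain ⟨v, hv⟩ := exists_ne (0 : V)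
  have hsurj (a : K) : ∃ w, (f - algebraMap K (Module.End K V) a) w = v := by
    have := hunit (X - C a) (X_sub_C_ne_zero a)
    rw [map_sub, aeval_X, aeval_C, Module.End.isUnit_iff] at this
    exact this.2 v
  choose w hw using hsurj
  refine h.not_ge (linearIndependent_of_sub_algebraMap_apply_eq (fun p hp ↦ ?_) hw
    |>.cardinal_lift_le_rank)
  by_contra hp0
  exact hv (((Module.End.isUnit_iff _).1 (hunit p hp0)).1 (hp.trans (map_zero _).symm))

/-- For a unital `ℂ`-algebra `A` of at most countable dimension and a simple left
`A`-module `V`, every `A`-module endomorphism of `V` is multiplication by a unique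
complex scalar; i.e. the natural map `ℂ → End_A(V)` is bijective. -/
theorem endomorphism_of_simple_module_is_scalar
    (A : Type) [Ring A] [Algebra ℂ A] (hdim : Module.rank ℂ A ≤ Cardinal.aleph0)
    (V : Type) [AddCommGroup V] [Module A V] [IsSimpleModule A V]
    (g : V →ₗ[A] V) :
    ∃! c : ℂ, ∀ v : V, g v = algebraMap ℂ A c • v := by
  let _ : Module ℂ V := Module.compHom V (algebraMap ℂ A)
  have : IsScalarTower ℂ A V := ⟨fun c a v ↦ by
    rw [Algebra.smul_def, mul_smul]; rfl⟩
  have : Nontrivial V := IsSimpleModule.nontrivial A V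
  obtain ⟨v, hv⟩ := exists_ne (0 : V)
  have hrank : Module.rank ℂ V ≤ Cardinal.aleph0 :=
    (LinearMap.rank_le_of_surjective ((LinearMap.toSpanSingleton A V v).restrictScalars ℂ)
      (IsSimpleModule.toSpanSingleton_surjective A hv)).trans hdim
  obtain ⟨c, hc⟩ := Module.End.spectrum_nonempty_of_rank_lt (g.restrictScalars ℂ) <| by
    rw [Cardinal.lift_id, Cardinal.lift_id, Cardinal.mk_complex]
    exact hrank.trans_lt Cardinal.aleph0_lt_continuum
  have hg : c • LinearMap.id - g = 0 := by
    refine (LinearMap.bijective_or_eq_zero _).resolve_left fun hb ↦ hc ?_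
    exact (Module.End.isUnit_iff _).2 hb
  refine ⟨c, fun u ↦ ?_, fun d hd ↦ ?_⟩
  · rw [algebraMap_smul]
    exact (sub_eq_zero.1 (LinearMap.congr_fun hg u)).symm
  · have h1 : d • v = c • v := by
      rw [← algebraMap_smul A d v, ← hd v]
      exact (sub_eq_zero.1 (LinearMap.congr_fun hg v)).symm
    exact smul_left_injective ℂ hv h1
end

section
/- Let k be a finitely generated commutative ℂ-algebra and A a unital finite type k-algebra. Then the Jacobson radical Jac(A) of A is nilpotent: Jac(A)^N = 0 for some N ≥ 1. Consequently, if J₁ ⊆ J₂ are two-sided ideals of A such that V(J₁) = V(J₂), then J₂/J₁ is a nilpotent ideal of A/J₁, i.e. J₂^N ⊆ J₁ for some N ≥ 1. -/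
namespace Ideal

variable {A : Type*} [Ring A]

/-- A relative form of Levitzki's theorem: in a left Noetherian ring, a two-sided ideal that is
nil modulo a two-sided ideal `I` is nilpotent modulo `I`. -/
theorem exists_pow_le_of_forall_exists_pow_mem [IsNoetherianRing A] (I J : Ideal A)
    [I.IsTwoSided] [J.IsTwoSided] (hnil : ∀ x ∈ J, ∃ n : ℕ, x ^ n ∈ I) :
    ∃ N : ℕ, 1 ≤ N ∧ J ^ N ≤ I := by
  let s : Set (Ideal A) := {S | S.IsTwoSided ∧ I ≤ S ∧ ∃ N : ℕ, 1 ≤ N ∧ S ^ N ≤ I}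
  obtain ⟨S, ⟨hS, hIS, N, hN, hSN⟩, hSmax⟩ : ∃ S : Ideal A, S ∈ s ∧ ∀ S' ∈ s, ¬S < S' :=
    set_has_maximal_iff_noetherian.mpr ‹_› s
      ⟨I, ‹_›, le_rfl, 1, le_rfl, (Submodule.pow_one I).le⟩
  by_cases hJS : J ≤ S
  · exact ⟨N, hN, (Ideal.pow_right_mono hJS N).trans hSN⟩
  exfalso
  let ann (x : A) : Ideal A := Submodule.comap (LinearMap.toSpanSingleton A A x) S
  have mem_ann (a x : A) : a ∈ ann x ↔ a * x ∈ S := by simp [ann]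
  obtain ⟨y, hyJ, hyS⟩ := SetLike.not_le_iff_exists.mp hJS
  obtain ⟨_, ⟨x, ⟨hxJ, hxS⟩, rfl⟩, hxmax⟩ := set_has_maximal_iff_noetherian.mpr ‹_›
    (ann '' {x | x ∈ J ∧ x ∉ S}) ⟨_, y, ⟨hyJ, hyS⟩, rfl⟩
  have hxax (a : A) : x * a * x ∈ S := by
    classical
    have hex : ∃ n, (x * a) ^ n ∈ S :=
      (hnil _ (J.mul_mem_right a hxJ)).imp fun _ h ↦ hIS h
    rcases hm : Nat.find hex with _ | _ | j
    · have h := Nat.find_spec hex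
      rw [hm, pow_zero] at h
      exact absurd (by simpa using S.mul_mem_left x h) hxS
    · have h := Nat.find_spec hex
      rw [hm, zero_add, pow_one] at h
      exact S.mul_mem_right x h
    · have h := Nat.find_spec hex
      rw [hm] at h
      have hlt : (x * a) ^ (j + 1) ∉ S := Nat.find_min hex (by omega)
      have hle : ann x ≤ ann ((x * a) ^ (j + 1)) := fun b hb ↦ by
        rw [mem_ann] at hb ⊢
        rw [pow_succ', mul_assoc x, ← mul_assoc b]
        exact S.mul_mem_right _ hb
      have hJ : (x * a) ^ (j + 1) ∈ J := by
        rw [pow_succ', mul_assoc]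
        exact J.mul_mem_right _ hxJ
      have heq : ann x = ann ((x * a) ^ (j + 1)) :=
        eq_of_le_of_not_lt hle (hxmax _ ⟨_, ⟨hJ, hlt⟩, rfl⟩)
      rw [← mem_ann, heq, mem_ann, ← pow_succ']
      exact h
  let T : Ideal A := span {x} * ⊤
  have hT : T.IsTwoSided := by dsimp only [T]; infer_instance
  have hxT : x ∈ T := by
    simpa using mul_mem_mul (mem_span_singleton_self x) (Submodule.mem_top (x := (1 : A)))
  have hxx : span {x} * span {x} ≤ S := mul_le.mpr fun r hr s hs ↦ by
    obtain ⟨a, rfl⟩ := mem_span_singleton'.mp hr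
    obtain ⟨b, rfl⟩ := mem_span_singleton'.mp hs
    have := S.mul_mem_left a (hxax b)
    simpa only [mul_assoc] using this
  have hTT : T * T ≤ S := by
    have : T * T = span {x} * span {x} * ⊤ := by
      simp only [T, Ideal.mul_assoc, top_mul]
    rw [this]
    exact (mul_mono_left hxx).trans mul_le_left
  have hsup : (S ⊔ T).IsTwoSided := ⟨fun b hr ↦ by
    obtain ⟨s, hs, t, ht, rfl⟩ := Submodule.mem_sup.mp hr
    rw [add_mul]
    exact Submodule.add_mem_sup (S.mul_mem_right b hs) (T.mul_mem_right b ht)⟩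
  have hsq : (S ⊔ T) * (S ⊔ T) ≤ S := by
    rw [mul_le]
    intro r hr s hs
    obtain ⟨r₁, hr₁, r₂, hr₂, rfl⟩ := Submodule.mem_sup.mp hr
    obtain ⟨s₁, hs₁, s₂, hs₂, rfl⟩ := Submodule.mem_sup.mp hs
    rw [add_mul, mul_add r₂]
    exact add_mem (S.mul_mem_right _ hr₁)
      (add_mem (S.mul_mem_left _ hs₁) (hTT (mul_mem_mul hr₂ hs₂)))
  refine hSmax (S ⊔ T) ⟨hsup, hIS.trans le_sup_left, 2 * N, by omega, ?_⟩
    (lt_of_le_not_ge le_sup_left fun h ↦ hxS (h (le_sup_right (a := S) hxT)))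
  have hpow (m : ℕ) : (S ⊔ T) ^ (2 * m) ≤ S ^ m := by
    induction m with
    | zero => exact le_rfl
    | succ m ih =>
      rw [Nat.mul_succ, Submodule.pow_succ, Submodule.pow_succ, Submodule.pow_succ, Ideal.mul_assoc]
      exact mul_mono ih hsq
  exact (hpow N).trans hSN

theorem list_prod_ofFn_mem_pow {I : Ideal A} {n : ℕ} (f : Fin n → A) (hf : ∀ i, f i ∈ I) :
    (List.ofFn f).prod ∈ I ^ n := by
  induction n with
  | zero => simp [Submodule.pow_zero]
  | succ n ih =>
    rw [List.ofFn_succ', List.prod_concat, Submodule.pow_succ]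
    exact mul_mem_mul (ih _ fun i ↦ hf i.castSucc) (hf (Fin.last n))

end Ideal

/-- A left inverse of `u` modulo a two-sided ideal that is integral over the base ring is, modulo
that ideal, a polynomial in `u`. -/
theorem exists_aeval_mul_sub_one_mem {k A : Type*} [CommRing k] [Ring A] [Algebra k A]
    (I : Ideal A) [I.IsTwoSided] {z u : A} (hz : IsIntegral k z) (hzu : z * u - 1 ∈ I) :
    ∃ q : Polynomial k, Polynomial.aeval u q * u - 1 ∈ I := by
  obtain ⟨p, hp, hpz⟩ := hz
  have hzu' (n : ℕ) : Ideal.Quotient.mk I (z ^ n * u ^ n) = 1 := by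
    rw [← sub_eq_zero, ← map_one (Ideal.Quotient.mk I), ← map_sub, Ideal.Quotient.eq_zero_iff_mem]
    induction n with
    | zero => simp
    | succ n ih =>
      have : z ^ (n + 1) * u ^ (n + 1) - 1 = z ^ n * (z * u - 1) * u ^ n + (z ^ n * u ^ n - 1) := by
        rw [pow_succ, pow_succ']
        noncomm_ring
      rw [this]
      exact I.add_mem (I.mul_mem_right _ (I.mul_mem_left _ hzu)) ih
  have hterm {n i : ℕ} (hi : i ≤ n) :
      Ideal.Quotient.mk I (z ^ i * u ^ n) = Ideal.Quotient.mk I (u ^ (n - i)) := by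
    rw [← Nat.add_sub_cancel' hi, pow_add, ← mul_assoc, map_mul, hzu', one_mul,
      Nat.add_sub_cancel_left]
  set n := p.natDegree
  refine ⟨-∑ i ∈ Finset.range n, Polynomial.C (p.coeff i) * Polynomial.X ^ (n - i - 1), ?_⟩
  rw [← Ideal.Quotient.eq_zero_iff_mem]
  have h0 : Polynomial.aeval z p * u ^ n = 0 := by
    rw [Polynomial.aeval_def, hpz, zero_mul]
  rw [Polynomial.aeval_eq_sum_range, Finset.sum_range_succ, hp.coeff_natDegree, one_smul,
    add_mul, Finset.sum_mul] at h0
  have h1 := congrArg (Ideal.Quotient.mk I) h0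
  rw [map_add, hzu', map_zero, map_sum] at h1
  rw [map_sub, map_one, map_neg, neg_mul, map_neg, ← neg_add', neg_eq_zero, ← h1, map_sum,
    Finset.sum_mul, map_sum]
  congr 1
  refine Finset.sum_congr rfl fun i hi ↦ ?_
  have hi := Finset.mem_range.mp hi
  have hu : u ^ (n - i - 1) * u = u ^ (n - i) := by
    rw [← pow_succ]; congr 1; omega
  rw [map_mul (Polynomial.aeval u), map_pow, Polynomial.aeval_C, Polynomial.aeval_X, mul_assoc, hu,
    map_mul, ← hterm hi.le, ← map_mul, Algebra.smul_def, mul_assoc]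

/-- If `A` is integral over a Jacobson ring, an element that lies in every primitive ideal
containing the two-sided ideal `I` is nilpotent modulo `I`. -/
theorem exists_pow_mem_of_forall_isPrimitiveIdeal {k : Type*} {A : Type} [CommRing k]
    [IsJacobsonRing k] [Ring A] [Algebra k A] [Algebra.IsIntegral k A]
    (I : Ideal A) [I.IsTwoSided] {x : A}
    (hx : ∀ P : Ideal A, IsPrimitiveIdeal A P → I ≤ P → x ∈ P) :
    ∃ n : ℕ, x ^ n ∈ I := by
  have hinv (y : A) : ∃ z : A, z * (y * x + 1) - 1 ∈ I := by
    by_cases htop : I ⊔ Ideal.span {y * x + 1} = ⊤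
    · obtain ⟨s, hs, t, ht, hst⟩ := Submodule.mem_sup.mp ((Ideal.eq_top_iff_one _).mp htop)
      obtain ⟨z, rfl⟩ := Ideal.mem_span_singleton'.mp ht
      refine ⟨z, ?_⟩
      have : z * (y * x + 1) - 1 = -s := by
        rw [eq_sub_iff_add_eq'.mpr hst, sub_sub_cancel_left]
      exact this ▸ I.neg_mem hs
    · exfalso
      obtain ⟨M, hM, hle⟩ := Ideal.exists_le_maximal _ htop
      have hsimple : IsSimpleModule A (A ⧸ M) := isSimpleModule_iff_isCoatom.mpr hM.out
      have hxM : x ∈ Module.annihilator A (A ⧸ M) := by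
        refine hx _ ⟨A ⧸ M, _, _, hsimple, rfl⟩ fun a ha ↦ Module.mem_annihilator.mpr fun v ↦ ?_
        obtain ⟨b, rfl⟩ := Submodule.Quotient.mk_surjective M v
        rw [← Submodule.Quotient.mk_smul, Submodule.Quotient.mk_eq_zero]
        exact hle (Ideal.mem_sup_left (I.mul_mem_right b ha))
      have h := Module.mem_annihilator.mp hxM (Submodule.Quotient.mk 1)
      rw [← Submodule.Quotient.mk_smul, Submodule.Quotient.mk_eq_zero, smul_eq_mul, mul_one] at h
      have hu : y * x + 1 ∈ M := hle (Ideal.mem_sup_right (Ideal.mem_span_singleton_self _))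
      exact hM.ne_top ((Ideal.eq_top_iff_one M).mpr
        ((M.add_mem_iff_right (M.mul_mem_left y h)).mp hu))
  let K : Ideal (Polynomial k) := I.comap (Polynomial.aeval x)
  have hK : Polynomial.X ∈ K.jacobson := Ideal.mem_jacobson_iff.mpr fun r ↦ by
    obtain ⟨z, hz⟩ := hinv (Polynomial.aeval x r)
    obtain ⟨q, hq⟩ := exists_aeval_mul_sub_one_mem (k := k) I (Algebra.IsIntegral.isIntegral z) hz
    refine ⟨q.comp (r * Polynomial.X + 1), ?_⟩
    rw [Ideal.mem_comap]
    simpa [Polynomial.aeval_comp, mul_add, mul_assoc] using hq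
  rw [← Ideal.radical_eq_jacobson] at hK
  obtain ⟨n, hn⟩ := hK
  exact ⟨n, by simpa [K, Ideal.mem_comap] using hn⟩

/-- Lemma (lemma.nilp): the Jacobson radical of a unital finite type `k`-algebra is
nilpotent (`Jac(A)^N = 0`, expressed via `N`-fold products), and consequently if
`J₁ ⊆ J₂` are two-sided ideals with `V(J₁) = V(J₂)` then `J₂^N ⊆ J₁` for some `N ≥ 1`. -/
theorem jacobson_radical_nilpotent_of_finite_type
    (k : Type) [CommRing k] [Algebra ℂ k] [Algebra.FiniteType ℂ k]
    (A : Type) [Ring A] [Algebra k A] [Module.Finite k A] :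
    (∃ N : ℕ, 1 ≤ N ∧
      ∀ f : Fin N → A, (∀ i, f i ∈ jacRad A) → (List.ofFn f).prod = 0) ∧
    ∀ J₁ J₂ : Ideal A,
      (∀ x ∈ J₁, ∀ a : A, x * a ∈ J₁) → (∀ x ∈ J₂, ∀ a : A, x * a ∈ J₂) →
      J₁ ≤ J₂ →
      {P : Ideal A | IsPrimitiveIdeal A P ∧ J₁ ≤ P} =
        {P : Ideal A | IsPrimitiveIdeal A P ∧ J₂ ≤ P} →
      ∃ N : ℕ, 1 ≤ N ∧
        ∀ f : Fin N → A, (∀ i, f i ∈ J₂) → (List.ofFn f).prod ∈ J₁ := by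
  have : IsJacobsonRing k := isJacobsonRing_of_finiteType (A := ℂ)
  have : IsNoetherianRing k := Algebra.FiniteType.isNoetherianRing ℂ k
  have : IsNoetherianRing A :=
    isNoetherian_of_tower k (isNoetherian_of_isNoetherianRing_of_finite k A)
  have key (I J : Ideal A) [I.IsTwoSided] [J.IsTwoSided]
      (h : ∀ P : Ideal A, IsPrimitiveIdeal A P → I ≤ P → J ≤ P) :
      ∃ N : ℕ, 1 ≤ N ∧ ∀ f : Fin N → A, (∀ i, f i ∈ J) → (List.ofFn f).prod ∈ I := by
    obtain ⟨N, hN, hle⟩ := I.exists_pow_le_of_forall_exists_pow_mem J fun x hx ↦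
      exists_pow_mem_of_forall_isPrimitiveIdeal (k := k) I fun P hP hIP ↦ h P hP hIP hx
    exact ⟨N, hN, fun f hf ↦ hle (Ideal.list_prod_ofFn_mem_pow f hf)⟩
  refine ⟨?_, fun J₁ J₂ h₁ h₂ _ hV ↦ ?_⟩
  · have : (jacRad A).IsTwoSided := ⟨fun b hx ↦ by
      refine Submodule.mem_sInf.mpr fun P hP ↦ ?_
      have hxP := Submodule.mem_sInf.mp hx P hP
      obtain ⟨V, _, _, _, rfl⟩ := hP
      exact Ideal.mul_mem_right b _ hxP⟩
    simpa only [Submodule.mem_bot] using key ⊥ (jacRad A) fun P hP _ ↦ sInf_le hP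
  · have : J₁.IsTwoSided := ⟨fun b hx ↦ h₁ _ hx b⟩
    have : J₂.IsTwoSided := ⟨fun b hx ↦ h₂ _ hx b⟩
    exact key J₁ J₂ fun P hP hle ↦ (hV.subset ⟨hP, hle⟩).2
end

section
/- Let k be a finitely generated commutative ℂ-algebra that is an integral domain and let A be a unital finite type k-algebra that is semi-primitive. Let Tor(A) := {a ∈ A : f·a = 0 for some nonzero f ∈ k} be the k-torsion submodule of A. Then Tor(A) is a two-sided ideal of A, and the quotient algebra A/Tor(A) is again semi-primitive. -/
/-- The `k`-torsion subset of `A`. -/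
def torsionSet (k A : Type) [CommRing k] [Ring A] [Algebra k A] : Set A :=
  {a : A | ∃ f : k, f ≠ 0 ∧ f • a = 0}

theorem mem_jacobson_bot_of_mem_jacRad {A : Type} [Ring A] {a : A} (ha : a ∈ jacRad A) :
    a ∈ (⊥ : Ideal A).jacobson := by
  rw [Ideal.jacobson, Ideal.mem_sInf]
  rintro M ⟨-, hM⟩
  have hs : IsSimpleModule A (A ⧸ M) :=
    isSimpleModule_iff_isCoatom.mpr (Ideal.isMaximal_def.mp hM)
  have h : a ∈ Module.annihilator A (A ⧸ M) :=
    (Submodule.mem_sInf.mp ha) _ ⟨A ⧸ M, inferInstance, inferInstance, hs, rfl⟩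
  have h1 := Module.mem_annihilator.mp h (Submodule.Quotient.mk (1 : A))
  rw [← Submodule.Quotient.mk_smul, Submodule.Quotient.mk_eq_zero] at h1
  simpa using h1

theorem mem_jacRad_of_forall_isNilpotent {A : Type} [Ring A] {a : A}
    (ha : ∀ c : A, IsNilpotent (c * a)) : a ∈ jacRad A := by
  refine Submodule.mem_sInf.mpr ?_
  rintro _ ⟨V, _, _, hV, rfl⟩
  refine Module.mem_annihilator.mpr fun v => ?_
  by_contra hv
  obtain ⟨c, hc⟩ := IsSimpleModule.toSpanSingleton_surjective A hv v
  obtain ⟨u, hu⟩ := (ha c).isUnit_one_sub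
  have h0 : (1 - c * a) • v = 0 := by
    rw [sub_smul, one_smul, mul_smul]
    exact sub_eq_zero.mpr hc.symm
  have hv0 : v = 0 := by
    rw [← one_smul A v, ← u.inv_mul, mul_smul, hu, h0, smul_zero]
  exact hv (by rw [hv0, smul_zero])

/-- A left inverse of `x`, if integral, is a polynomial in `x`. -/
theorem IsIntegral.exists_aeval_eq_of_mul_eq_one {k B : Type*} [CommRing k] [Ring B] [Algebra k B]
    {u x : B} (hu : IsIntegral k u) (hux : u * x = 1) :
    ∃ q : Polynomial k, Polynomial.aeval x q = u := by
  have hpow : ∀ n : ℕ, u ^ n * x ^ n = 1 := by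
    intro n
    induction n with
    | zero => simp
    | succ n ih => rw [pow_succ, pow_succ', mul_assoc, ← mul_assoc u, hux, one_mul, ih]
  have hmem : ∀ i n : ℕ, i ≤ n → u ^ i * x ^ n = x ^ (n - i) := by
    intro i n h
    obtain ⟨j, rfl⟩ := Nat.exists_eq_add_of_le h
    rw [pow_add, ← mul_assoc, hpow, one_mul, Nat.add_sub_cancel_left]
  nontriviality B
  obtain ⟨p, hp, hp0⟩ := hu
  rw [← Polynomial.aeval_def, Polynomial.aeval_eq_sum_range, Finset.sum_range_succ,
    hp.coeff_natDegree, one_smul] at hp0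
  obtain ⟨m, hm⟩ : ∃ m, p.natDegree = m + 1 := by
    refine Nat.exists_eq_succ_of_ne_zero fun h => ?_
    simp [h] at hp0
  rw [hm] at hp0
  have h := congrArg (· * x ^ m) hp0
  simp only [add_mul, zero_mul, Finset.sum_mul] at h
  rw [pow_succ', mul_assoc, hpow, mul_one] at h
  refine ⟨-∑ i ∈ Finset.range (m + 1), Polynomial.C (p.coeff i) * Polynomial.X ^ (m - i), ?_⟩
  rw [eq_neg_of_add_eq_zero_right h]
  simp only [map_neg, map_sum, map_mul, Polynomial.aeval_C, map_pow, Polynomial.aeval_X]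
  congr 1
  refine Finset.sum_congr rfl fun i hi => ?_
  rw [smul_mul_assoc, hmem i m (by grind), Algebra.smul_def]

theorem isNilpotent_of_mem_jacobson_bot {k B : Type*} [CommRing k] [IsJacobsonRing k] [Ring B]
    [Algebra k B] [Algebra.IsIntegral k B] {b : B} (hb : b ∈ (⊥ : Ideal B).jacobson) :
    IsNilpotent b := by
  let I : Ideal (Polynomial k) := RingHom.ker (Polynomial.aeval (R := k) b)
  have hX : (Polynomial.X : Polynomial k) ∈ I.jacobson := by
    refine Ideal.mem_jacobson_iff.mpr fun y => ?_
    obtain ⟨u, hu⟩ := Ideal.mem_jacobson_iff.mp hb (Polynomial.aeval b y)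
    have hu1 : u * Polynomial.aeval b (y * Polynomial.X + 1) = 1 := by
      rw [Ideal.mem_bot, sub_eq_zero] at hu
      simpa [mul_add, mul_assoc] using hu
    obtain ⟨q, hq⟩ :=
      (Algebra.IsIntegral.isIntegral (R := k) u).exists_aeval_eq_of_mul_eq_one hu1
    refine ⟨q.comp (y * Polynomial.X + 1), ?_⟩
    have hq' : Polynomial.aeval b (q.comp (y * Polynomial.X + 1)) = u := by
      rw [Polynomial.aeval_comp, hq]
    rw [RingHom.mem_ker, map_sub, map_add, map_mul, map_mul, hq', Polynomial.aeval_X, map_one]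
    exact hu
  rw [← Ideal.radical_eq_jacobson] at hX
  obtain ⟨n, hn⟩ := hX
  exact ⟨n, by simpa [I, RingHom.mem_ker] using hn⟩

theorem coe_torsion_eq_torsionSet (k A : Type) [CommRing k] [IsDomain k] [Ring A] [Algebra k A] :
    (Submodule.torsion k A : Set A) = torsionSet k A := by
  ext a
  constructor
  · rintro ⟨f, hf⟩
    exact ⟨f, nonZeroDivisors.ne_zero f.2, hf⟩
  · rintro ⟨f, hf, h⟩
    exact ⟨⟨f, mem_nonZeroDivisors_of_ne_zero hf⟩, h⟩

theorem exists_ne_zero_forall_mem_torsionSet_smul_eq_zero (k A : Type) [CommRing k] [IsDomain k]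
    [IsNoetherianRing k] [Ring A] [Algebra k A] [Module.Finite k A] :
    ∃ f : k, f ≠ 0 ∧ ∀ a ∈ torsionSet k A, f • a = 0 := by
  obtain ⟨f, hf, hf0⟩ := Submodule.annihilator_top_inter_nonZeroDivisors
    (Submodule.torsion_isTorsion (R := k) (M := A))
  refine ⟨f, nonZeroDivisors.ne_zero hf0, fun a ha => ?_⟩
  rw [← coe_torsion_eq_torsionSet] at ha
  exact congrArg Subtype.val (Submodule.mem_annihilator.mp hf ⟨a, ha⟩ trivial)

/-- For a semi-primitive unital finite type algebra `A` over an integral domain `k`,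
the torsion submodule `Tor(A)` is a two-sided ideal and `A/Tor(A)` (presented as any
surjective image of `A` with kernel `Tor(A)`) is again semi-primitive. -/
theorem torsion_ideal_and_quotient_semiprimitive
    (k : Type) [CommRing k] [Algebra ℂ k] [Algebra.FiniteType ℂ k] [IsDomain k]
    (A : Type) [Ring A] [Algebra k A] [Module.Finite k A]
    (hA : jacRad A = ⊥) :
    (∃ I : Ideal A, (I : Set A) = torsionSet k A ∧ ∀ x ∈ I, ∀ a : A, x * a ∈ I) ∧
    ∀ (B : Type) [Ring B] [Algebra k B],
      ∀ π : A →ₐ[k] B, Function.Surjective π →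
        (∀ a : A, π a = 0 ↔ a ∈ torsionSet k A) →
        jacRad B = ⊥ := by
  constructor
  · let T : Submodule k A := Submodule.torsion k A
    have hT : (T : Set A) = torsionSet k A := coe_torsion_eq_torsionSet k A
    refine ⟨{ carrier := torsionSet k A, add_mem' := ?_, zero_mem' := ?_, smul_mem' := ?_ },
      rfl, ?_⟩
    · rw [← hT]
      exact T.add_mem
    · rw [← hT]
      exact T.zero_mem
    · rintro c x ⟨f, hf, h⟩
      exact ⟨f, hf, by rw [smul_eq_mul, ← mul_smul_comm, h, mul_zero]⟩
    · rintro x ⟨f, hf, h⟩ a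
      exact ⟨f, hf, by rw [← smul_mul_assoc, h, zero_mul]⟩
  · intro B _ _ π hπ hker
    have : IsNoetherianRing k := Algebra.FiniteType.isNoetherianRing ℂ k
    have : IsJacobsonRing k := isJacobsonRing_of_finiteType (A := ℂ)
    have : Module.Finite k B := Module.Finite.of_surjective π.toLinearMap hπ
    obtain ⟨f, hf, hfT⟩ := exists_ne_zero_forall_mem_torsionSet_smul_eq_zero k A
    refine (Submodule.eq_bot_iff _).mpr fun b hb => ?_
    obtain ⟨a, rfl⟩ := hπ b
    have hfa : f • a ∈ jacRad A := by
      refine mem_jacRad_of_forall_isNilpotent fun c => ?_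
      obtain ⟨n, hn⟩ := isNilpotent_of_mem_jacobson_bot (k := k)
        (mem_jacobson_bot_of_mem_jacRad (Ideal.mul_mem_left _ (π c) hb))
      rw [← map_mul, ← map_pow, hker] at hn
      refine ⟨n + 1, ?_⟩
      rw [mul_smul_comm, smul_pow, pow_succ f, mul_smul, pow_succ (c * a), ← smul_mul_assoc f,
        hfT _ hn, zero_mul, smul_zero]
    rw [hA, Ideal.mem_bot] at hfa
    exact (hker a).mpr ⟨f, hf, hfa⟩
end

section
/- Let k be a finitely generated commutative ℂ-algebra that is an integral domain and let A be a (not necessarily unital) finite type k-algebra that is semi-primitive. Then the set S₁ := {p ∈ Max(k) : the localization A_p := A ⊗_k k_p has a two-sided multiplicative identity} is open and dense in Max(k), where Max(k) is the maximal ideal spectrum of k with the Zariski topology. (The zero algebra counts as having an identity.) -/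
open scoped TensorProduct

section NonUnitalJac
variable (k A : Type) [CommRing k] [NonUnitalRing A] [Module k A]
  [IsScalarTower k A A] [SMulCommClass k A A]

/-- The Jacobson radical of a possibly nonunital algebra `A`: the intersection of the
ideals `P ∩ A`, where `P` ranges over the primitive ideals of the unitization
`A⁺ = Unitization k A` not containing `A`. -/
def nuJacSet : Set A :=
  {a : A | ∀ P : Ideal (Unitization k A), IsPrimitiveIdeal (Unitization k A) P →
      ¬ (∀ x : A, (Unitization.inr x : Unitization k A) ∈ P) →
      (Unitization.inr a : Unitization k A) ∈ P}

end NonUnitalJac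

/-- The locus of maximal ideals `p` of `k` where the localization `A_p = A ⊗_k k_p`
has a two-sided multiplicative identity. -/
def unitalLocus (k A : Type) [CommRing k] [NonUnitalRing A] [Module k A]
    [IsScalarTower k A A] [SMulCommClass k A A] : Set (MaximalSpectrum k) :=
  {p : MaximalSpectrum k |
    ∃ e : A ⊗[k] (Localization.AtPrime p.asIdeal), ∀ x, e * x = x ∧ x * e = x}

section Unital

theorem isSemisimpleRing_of_mul_mul_eq_zero {R : Type*} [Ring R] [IsArtinianRing R]
    (h : ∀ a : R, (∀ x, a * x * a = 0) → a = 0) : IsSemisimpleRing R := by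
  rw [IsArtinianRing.isSemisimpleRing_iff_jacobson]
  obtain ⟨n, hn⟩ := IsSemiprimaryRing.isNilpotent (R := R)
  induction n with
  | zero =>
    rw [Submodule.pow_zero, Ideal.one_eq_top] at hn
    exact le_bot_iff.1 (le_top.trans_eq hn)
  | succ n ih =>
    cases n with
    | zero => rwa [zero_add, Submodule.pow_one] at hn
    | succ n =>
      refine ih ((Submodule.eq_bot_iff _).2 fun a ha => h a fun x => ?_)
      have haJ : a ∈ Ring.jacobson R := by
        rw [Submodule.pow_succ] at ha
        exact Ideal.mul_le_right ha
      have : a * (x * a) ∈ Ring.jacobson R ^ (n + 1) * Ring.jacobson R :=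
        Ideal.mul_mem_mul ha (Ideal.mul_mem_left _ x haJ)
      rwa [← Submodule.pow_succ, hn, ← mul_assoc] at this

theorem exists_identity_of_mul_mul_eq_zero (K B : Type*) [Field K] [NonUnitalRing B] [Module K B]
    [IsScalarTower K B B] [SMulCommClass K B B] [Module.Finite K B]
    (h : ∀ a : B, (∀ x, a * x * a = 0) → a = 0) :
    ∃ e : B, ∀ x, e * x = x ∧ x * e = x := by
  have : Module.Finite K (Unitization K B) :=
    Module.Finite.equiv (Unitization.linearEquiv K K B).symm
  have : IsArtinianRing (Unitization K B) := IsArtinianRing.of_finite K _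
  have hss : IsSemisimpleRing (Unitization K B) := by
    refine isSemisimpleRing_of_mul_mul_eq_zero fun u hu => ?_
    have hfst : u.fst = 0 := by
      have := congrArg (·.fst) (hu 1)
      simpa using this
    have hu' : u = Unitization.inr u.snd := by ext <;> simp [hfst]
    rw [hu'] at hu ⊢
    rw [h u.snd, Unitization.inr_zero]
    intro x
    apply Unitization.inr_injective (R := K)
    simpa using hu (Unitization.inr x)
  let I : Ideal (Unitization K B) :=
    { carrier := {u | u.fst = 0}
      add_mem' := by intro a b ha hb; simp_all
      zero_mem' := by simp
      smul_mem' := by intro a b hb; simp_all }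
  obtain ⟨C, hC⟩ := exists_isCompl I
  obtain ⟨e, he, f, hf, hef⟩ := Submodule.mem_sup.1
    (hC.sup_eq_top ▸ Submodule.mem_top : (1 : Unitization K B) ∈ I ⊔ C)
  have he' : e = Unitization.inr e.snd := by
    ext
    · exact he
    · simp
  have hright : ∀ x : B, x * e.snd = x := by
    intro x
    have hx : (Unitization.inr x : Unitization K B) ∈ I := Unitization.fst_inr K x
    have h1 : Unitization.inr x * f = Unitization.inr x - Unitization.inr x * e := by
      rw [eq_sub_iff_add_eq, ← mul_add, add_comm f, hef, mul_one]
    have h2 : Unitization.inr x * f = 0 := by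
      have : Unitization.inr x * f ∈ I ⊓ C :=
        ⟨h1 ▸ I.sub_mem hx (I.mul_mem_left _ he), C.smul_mem _ hf⟩
      rwa [hC.inf_eq_bot] at this
    apply Unitization.inr_injective (R := K)
    rw [Unitization.inr_mul, ← he', eq_comm, ← sub_eq_zero, ← h1, h2]
  refine ⟨e.snd, fun x => ⟨?_, hright x⟩⟩
  rw [← sub_eq_zero]
  refine h _ fun y => ?_
  rw [mul_assoc, mul_sub, ← mul_assoc y, hright, sub_self, mul_zero]

end Unital

section SemiPrimitive

variable {k A : Type} [CommRing k] [NonUnitalRing A] [Module k A]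
  [IsScalarTower k A A] [SMulCommClass k A A]

theorem mem_nuJacSet_of_mul_mul_eq_zero {a : A} (ha : ∀ x, a * x * a = 0) :
    a ∈ nuJacSet k A := by
  rintro P ⟨V, _, _, hV, rfl⟩ hA
  by_contra haP
  simp only [Module.mem_annihilator, not_forall] at haP hA
  obtain ⟨v, hv⟩ := haP
  obtain ⟨x₀, v₀, hx₀⟩ := hA
  have inr_mul_eq (x : A) (r : Unitization k A) :
      Unitization.inr x * r = Unitization.inr (Unitization.inr x * r).snd := by
    ext <;> simp
  have mul_inr_eq (x : A) (r : Unitization k A) :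
      r * Unitization.inr x = Unitization.inr (r * Unitization.inr x).snd := by
    ext <;> simp
  let W : Submodule (Unitization k A) V :=
    { carrier := {w | ∀ x : A, (Unitization.inr x : Unitization k A) • w = 0}
      add_mem' := by intro a b ha hb x; rw [smul_add, ha, hb, add_zero]
      zero_mem' := by intro x; rw [smul_zero]
      smul_mem' := by
        intro r w hw x
        rw [← mul_smul, inr_mul_eq]
        exact hw _ }
  have hW : W = ⊥ := (eq_bot_or_eq_top W).resolve_right fun h =>
    hx₀ ((h ▸ Submodule.mem_top : v₀ ∈ W) x₀)
  let w : V := (Unitization.inr a : Unitization k A) • v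
  let N : Submodule (Unitization k A) V :=
    { carrier := {u | ∃ x : A, (Unitization.inr x : Unitization k A) • w = u}
      add_mem' := by
        rintro _ _ ⟨x, rfl⟩ ⟨y, rfl⟩
        exact ⟨x + y, by rw [Unitization.inr_add, add_smul]⟩
      zero_mem' := ⟨0, by rw [Unitization.inr_zero, zero_smul]⟩
      smul_mem' := by
        rintro r _ ⟨x, rfl⟩
        exact ⟨_, by rw [← mul_inr_eq, mul_smul]⟩ }
  have hN : N = ⊤ := (eq_bot_or_eq_top N).resolve_left fun h => by
    have : w ∈ W := fun x => by
      have : (Unitization.inr x : Unitization k A) • w ∈ N := ⟨x, rfl⟩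
      rwa [h] at this
    rw [hW] at this
    exact hv this
  obtain ⟨x, hx⟩ : v ∈ N := hN ▸ Submodule.mem_top
  apply hv
  rw [← hx, ← mul_smul, ← Unitization.inr_mul, ← mul_smul, ← Unitization.inr_mul, ha,
    Unitization.inr_zero, zero_smul]

end SemiPrimitive

section Localization

variable {k A B : Type*} [CommRing k] [NonUnitalRing A] [Module k A]
  [IsScalarTower k A A] [SMulCommClass k A A] [Module.Finite k A]
  [NonUnitalNonAssocRing B] [Module k B] [IsScalarTower k B B] [SMulCommClass k B B]

theorem exists_identity_iff_of_isLocalizedModule (S : Submonoid k) (f : A →ₗ[k] B)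
    [IsLocalizedModule S f] (hf : ∀ x y, f (x * y) = f x * f y) :
    (∃ e : B, ∀ x, e * x = x ∧ x * e = x) ↔
      ∃ s ∈ S, ∃ a : A, ∀ x, a * x = s • x ∧ x * a = s • x := by
  constructor
  · rintro ⟨e, he⟩
    obtain ⟨⟨a, s⟩, hs⟩ := IsLocalizedModule.surj S f e
    have hs : (s : k) • e = f a := hs
    obtain ⟨t₁, h₁⟩ := Module.Finite.exists_smul_of_comp_eq_of_isLocalizedModule S f
      (LinearMap.mulLeft k a) ((s : k) • LinearMap.id) (by
        ext x; simp [hf, ← hs, smul_mul_assoc, he])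
    obtain ⟨t₂, h₂⟩ := Module.Finite.exists_smul_of_comp_eq_of_isLocalizedModule S f
      (LinearMap.mulRight k a) ((s : k) • LinearMap.id) (by
        ext x; simp [hf, ← hs, mul_smul_comm, he])
    have h₁ (x : A) : (t₁ : k) • (a * x) = (t₁ : k) • (s : k) • x := LinearMap.congr_fun h₁ x
    have h₂ (x : A) : (t₂ : k) • (x * a) = (t₂ : k) • (s : k) • x := LinearMap.congr_fun h₂ x
    refine ⟨t₂ * t₁ * s, S.mul_mem (S.mul_mem t₂.2 t₁.2) s.2, ((t₂ * t₁ : S) : k) • a,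
      fun x => ⟨?_, ?_⟩⟩
    · rw [smul_mul_assoc, Submonoid.coe_mul, mul_smul, h₁, mul_smul, mul_smul]
    · rw [mul_smul_comm, Submonoid.coe_mul, mul_comm (t₂ : k), mul_smul, h₂, mul_smul, mul_smul]
  · rintro ⟨s, hs, a, ha⟩
    have hinj (t : S) {x y : B} (h : (t : k) • x = (t : k) • y) : x = y :=
      IsLocalizedModule.smul_injective f t h
    refine ⟨IsLocalizedModule.mk' f a ⟨s, hs⟩, fun x => ?_⟩
    have he : s • IsLocalizedModule.mk' f a ⟨s, hs⟩ = f a :=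
      IsLocalizedModule.mk'_cancel' f a ⟨s, hs⟩
    obtain ⟨⟨b, t⟩, ht⟩ := IsLocalizedModule.surj S f x
    have ht : (t : k) • x = f b := ht
    constructor <;> apply hinj t <;> apply hinj ⟨s, hs⟩
    · rw [← mul_smul_comm, ht, ← smul_mul_assoc, he, ← hf, (ha b).1, map_smul]
    · rw [← smul_mul_assoc, ht, ← mul_smul_comm, he, ← hf, (ha b).2, map_smul]

end Localization

section GenericFibre

variable {k A : Type} [CommRing k] [NonUnitalRing A] [Module k A]
  [IsScalarTower k A A] [SMulCommClass k A A] [Module.Finite k A]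

theorem fractionRing_tensor_semiprime (h : ∀ a : A, (∀ x, a * x * a = 0) → a = 0)
    (b : FractionRing k ⊗[k] A) (hb : ∀ x, b * x * b = 0) : b = 0 := by
  let f : A →ₗ[k] FractionRing k ⊗[k] A := TensorProduct.mk k (FractionRing k) A 1
  have hf (x y : A) : f (x * y) = f x * f y := by simp [f]
  obtain ⟨⟨a, s⟩, hs⟩ := IsLocalizedModule.surj (nonZeroDivisors k) f b
  have hs : (s : k) • b = f a := hs
  obtain ⟨t, ht⟩ := Module.Finite.exists_smul_of_comp_eq_of_isLocalizedModule (nonZeroDivisors k) f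
    (LinearMap.mulRight k a ∘ₗ LinearMap.mulLeft k a) 0 (by
      ext x; simp [hf, ← hs, smul_mul_assoc, mul_smul_comm, hb])
  have ht (x : A) : (t : k) • (a * x * a) = 0 :=
    (LinearMap.congr_fun ht x).trans (smul_zero t)
  have hta : (t : k) • a = 0 := h _ fun x => by
    rw [smul_mul_assoc, mul_smul_comm, smul_mul_assoc, ht, smul_zero]
  apply IsLocalizedModule.smul_injective f (t * s)
  change ((t : k) * s) • b = ((t : k) * s) • (0 : FractionRing k ⊗[k] A)
  rw [mul_smul, hs, ← map_smul, hta, map_zero, smul_zero]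

theorem exists_smul_identity [IsDomain k] (h : ∀ a : A, (∀ x, a * x * a = 0) → a = 0) :
    ∃ s : k, s ≠ 0 ∧ ∃ a : A, ∀ x, a * x = s • x ∧ x * a = s • x := by
  obtain ⟨s, hs, ha⟩ := (exists_identity_iff_of_isLocalizedModule (nonZeroDivisors k)
    (TensorProduct.mk k (FractionRing k) A 1) (by simp)).1
      (exists_identity_of_mul_mul_eq_zero (FractionRing k) (FractionRing k ⊗[k] A)
        (fractionRing_tensor_semiprime h))
  exact ⟨s, nonZeroDivisors.ne_zero hs, ha⟩

end GenericFibre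

theorem mem_unitalLocus_iff {k A : Type} [CommRing k] [NonUnitalRing A] [Module k A]
    [IsScalarTower k A A] [SMulCommClass k A A] [Module.Finite k A] (p : MaximalSpectrum k) :
    p ∈ unitalLocus k A ↔
      ∃ s ∉ p.asIdeal, ∃ a : A, ∀ x, a * x = s • x ∧ x * a = s • x := by
  let L := Localization.AtPrime p.asIdeal
  let f : A →ₗ[k] A ⊗[k] L :=
    (TensorProduct.comm k L A).toLinearMap ∘ₗ TensorProduct.mk k L A 1
  have : IsLocalizedModule p.asIdeal.primeCompl f := IsLocalizedModule.of_linearEquiv _ _ _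
  exact exists_identity_iff_of_isLocalizedModule p.asIdeal.primeCompl f (by simp [f])

theorem MaximalSpectrum.isOpen_setOf_notMem {k : Type*} [CommRing k] (s : k) :
    IsOpen {p : MaximalSpectrum k | s ∉ p.asIdeal} :=
  (PrimeSpectrum.isOpen_basicOpen (a := s)).preimage MaximalSpectrum.toPrimeSpectrum_continuous

theorem MaximalSpectrum.dense_setOf_notMem {k : Type*} [CommRing k] [IsDomain k]
    [IsJacobsonRing k] {s : k} (hs : s ≠ 0) :
    Dense {p : MaximalSpectrum k | s ∉ p.asIdeal} := by
  rw [dense_iff_inter_open]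
  rintro _ ⟨U, hU, rfl⟩ ⟨q, hq⟩
  obtain ⟨_, ⟨t, rfl⟩, hqt, htU⟩ :=
    PrimeSpectrum.isTopologicalBasis_basic_opens.exists_subset_of_mem_open hq hU
  have ht : t ≠ 0 := fun h => hqt (h ▸ q.asIdeal.zero_mem)
  have hjac : (⊥ : Ideal k).jacobson = ⊥ :=
    IsJacobsonRing.out ‹_› (Ideal.isPrime_bot (α := k)).isRadical
  have hst : t * s ∉ (⊥ : Ideal k).jacobson := by
    rw [hjac]
    exact mul_ne_zero ht hs
  simp only [Ideal.jacobson, Submodule.mem_sInf, not_forall] at hst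
  obtain ⟨m, ⟨-, hm⟩, hmst⟩ := hst
  exact ⟨⟨m, hm⟩, htU fun h => hmst (Ideal.mul_mem_right _ m h), fun h => hmst (Ideal.mul_mem_left m _ h)⟩

/-- Lemma (lemma.Sone): if `A` is a semi-primitive finite type algebra over an integral
domain `k`, then the set of maximal ideals `p` of `k` at which the localization
`A_p = A ⊗_k k_p` is unital is open and dense in `Max(k)` with the Zariski topology. -/
theorem unital_locus_open_dense
    (k : Type) [CommRing k] [Algebra ℂ k] [Algebra.FiniteType ℂ k] [IsDomain k]
    (A : Type) [NonUnitalRing A] [Module k A]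
    [IsScalarTower k A A] [SMulCommClass k A A] [Module.Finite k A]
    (hA : nuJacSet k A = {0}) :
    IsOpen (unitalLocus k A) ∧ Dense (unitalLocus k A) := by
  refine ⟨isOpen_iff_forall_mem_open.2 fun p hp => ?_, ?_⟩
  · obtain ⟨s, hs, ha⟩ := (mem_unitalLocus_iff p).1 hp
    exact ⟨_, fun q hq => (mem_unitalLocus_iff q).2 ⟨s, hq, ha⟩,
      MaximalSpectrum.isOpen_setOf_notMem s, hs⟩
  · have : IsJacobsonRing k := isJacobsonRing_of_finiteType (A := ℂ)
    obtain ⟨s, hs, ha⟩ := exists_smul_identity (k := k) (A := A) fun a ha =>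
      (hA ▸ mem_nuJacSet_of_mul_mul_eq_zero ha : a ∈ ({0} : Set A))
    exact (MaximalSpectrum.dense_setOf_notMem hs).mono fun q hq =>
      (mem_unitalLocus_iff q).2 ⟨s, hq, ha⟩
end

section
/- Let k be a finitely generated commutative ℂ-algebra that is an integral domain and let A be a unital, semi-primitive finite type k-algebra. Then the set S₂ := {p ∈ Max(k) : the localization A_p := A ⊗_k k_p is an Azumaya algebra over its center} is open and dense in Max(k), where Max(k) is the maximal ideal spectrum of k with the Zariski topology. -/
open scoped TensorProduct

/-- The natural map `B ⊗_R B^op → End_R(B)`, sending `a ⊗ b` to `x ↦ a * x * b`. -/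
noncomputable def mulLeftRightMap (R B : Type) [CommRing R] [Ring B] [Algebra R B] :
    B ⊗[R] Bᵐᵒᵖ →ₗ[R] (B →ₗ[R] B) :=
  TensorProduct.lift <| LinearMap.mk₂ R
    (fun a b => (LinearMap.mulLeft R a) ∘ₗ (LinearMap.mulRight R b.unop))
    (fun a₁ a₂ b => by ext x; simp [add_mul])
    (fun r a b => by ext x; simp [smul_mul_assoc])
    (fun a b₁ b₂ => by ext x; simp [mul_add])
    (fun r a b => by ext x; simp [mul_smul_comm])

/-- `B` is an Azumaya algebra over its center `Z(B)`: it is a finitely generated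
projective and faithful `Z(B)`-module, and the natural map
`B ⊗_{Z(B)} B^op → End_{Z(B)}(B)` is an isomorphism. -/
def IsAzumayaOverCenter (B : Type) [Ring B] : Prop :=
  Module.Finite (Subring.center B) B ∧ Module.Projective (Subring.center B) B ∧
    FaithfulSMul (Subring.center B) B ∧
    Function.Bijective (mulLeftRightMap (Subring.center B) B)

/-- The locus of maximal ideals `p` of `k` where `A_p = A ⊗_k k_p` is an Azumaya
algebra over its center. -/
def azumayaLocus (k A : Type) [CommRing k] [Ring A] [Algebra k A] :
    Set (MaximalSpectrum k) :=
  {p : MaximalSpectrum k |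
    IsAzumayaOverCenter (A ⊗[k] (Localization.AtPrime p.asIdeal))}

/-- Multiplication by `z` on `B` is a finite sum of maps `y ↦ φ y * x`, where each `φ` is an inner
map `y ↦ ∑ j, a j * y * b j` with values in the center. For `z = 1` this is an explicit form of
the Azumaya property over the center. -/
def HasCentralDualBasis (B : Type) [Ring B] (z : B) : Prop :=
  ∃ (ι : Type) (_ : Fintype ι) (κ : ι → Type) (_ : ∀ i, Fintype (κ i))
    (x : ι → B) (a b : ∀ i, κ i → B),
    (∀ i y, ∑ j, a i j * y * b i j ∈ Subring.center B) ∧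
      ∀ y, ∑ i, (∑ j, a i j * y * b i j) * x i = z * y

theorem mulLeftRightMap_tmul (R B : Type) [CommRing R] [Ring B] [Algebra R B] (a : B) (b : Bᵐᵒᵖ)
    (y : B) : mulLeftRightMap R B (a ⊗ₜ b) y = a * y * b.unop := by
  simp [mulLeftRightMap, mul_assoc]

theorem exists_mulLeftRightMap_eq_sum (R B : Type) [CommRing R] [Ring B] [Algebra R B]
    (t : B ⊗[R] Bᵐᵒᵖ) : ∃ (κ : Type) (_ : Fintype κ) (a b : κ → B),
      t = ∑ j, a j ⊗ₜ MulOpposite.op (b j) ∧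
      ∀ y, mulLeftRightMap R B t y = ∑ j, a j * y * b j := by
  obtain ⟨s, rfl⟩ := TensorProduct.exists_finset t
  refine ⟨s, inferInstance, fun p ↦ p.1.1, fun p ↦ p.1.2.unop, ?_, fun y ↦ ?_⟩
  · simpa using (Finset.sum_coe_sort s fun p ↦ p.1 ⊗ₜ[R] p.2).symm
  · rw [map_sum, LinearMap.sum_apply]
    simp only [mulLeftRightMap_tmul]
    exact (Finset.sum_coe_sort s fun p ↦ p.1 * y * p.2.unop).symm

theorem hasCentralDualBasis_of_mulLeftRightMap {B : Type} [Ring B] {ι : Type} [Fintype ι]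
    (x : ι → B) (f : ι → B → Subring.center B) (hf : ∀ y, ∑ i, f i y • x i = y)
    (t : ι → B ⊗[Subring.center B] Bᵐᵒᵖ)
    (ht : ∀ i y, mulLeftRightMap (Subring.center B) B (t i) y = f i y) :
    HasCentralDualBasis B 1 := by
  choose κ hκ a b _ hab using fun i ↦ exists_mulLeftRightMap_eq_sum _ _ (t i)
  refine ⟨ι, inferInstance, κ, hκ, x, a, b, fun i y ↦ ?_, fun y ↦ ?_⟩
  · rw [← hab, ht]
    exact (f i y).2
  · simp_rw [← hab, ht, one_mul]
    exact hf y

theorem IsAzumayaOverCenter.hasCentralDualBasis {B : Type} [Ring B] (h : IsAzumayaOverCenter B) :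
    HasCentralDualBasis B 1 := by
  obtain ⟨_, _, _, _, hsurj⟩ := h
  obtain ⟨n, f, g, -, -, hfg⟩ := Module.Finite.exists_comp_eq_id_of_projective (Subring.center B) B
  choose t ht using fun i ↦ hsurj (Algebra.linearMap (Subring.center B) B ∘ₗ LinearMap.proj i ∘ₗ g)
  refine hasCentralDualBasis_of_mulLeftRightMap (fun i ↦ f (Pi.single i 1)) (fun i y ↦ g y i)
    (fun y ↦ ?_) t (fun i y ↦ by rw [ht]; rfl)
  conv_rhs => rw [← LinearMap.id_apply (R := Subring.center B) y, ← hfg, LinearMap.comp_apply,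
    pi_eq_sum_univ' (g y), map_sum]
  simp_rw [← map_smul]

theorem HasCentralDualBasis.isAzumayaOverCenter {B : Type} [Ring B]
    (h : HasCentralDualBasis B 1) : IsAzumayaOverCenter B := by
  obtain ⟨ι, _, κ, _, x, a, b, hc, hx⟩ := h
  let R := Subring.center B
  let t (i : ι) : B ⊗[R] Bᵐᵒᵖ := ∑ j, a i j ⊗ₜ MulOpposite.op (b i j)
  have ht (i : ι) (y : B) : mulLeftRightMap R B (t i) y = ∑ j, a i j * y * b i j := by
    simp [t, mulLeftRightMap_tmul]
  let f (i : ι) : B →ₗ[R] R :=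
    { toFun y := ⟨mulLeftRightMap R B (t i) y, ht i y ▸ hc i y⟩
      map_add' y z := by ext; simp
      map_smul' r y := Subtype.ext (map_smul (mulLeftRightMap R B (t i)) r y) }
  have hf (i : ι) (y : B) : (f i y : B) = ∑ j, a i j * y * b i j := ht i y
  have hx' (y : B) : ∑ i, f i y • x i = y := by
    simpa [Subring.smul_def, hf] using hx y
  let g : (ι → R) →ₗ[R] B := Fintype.linearCombination R x
  have hg : g ∘ₗ LinearMap.pi f = LinearMap.id := by
    ext y
    simpa [g, Fintype.linearCombination_apply] using hx' y
  refine ⟨.of_surjective g fun y ↦ ⟨_, LinearMap.congr_fun hg y⟩, .of_split _ _ hg, ⟨?_⟩, ?_, ?_⟩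
  · intro r s h
    simpa [Subring.smul_def] using h (1 : B)
  · rw [injective_iff_map_eq_zero]
    intro t' ht'
    obtain ⟨J, _, c, d, rfl, hcd⟩ := exists_mulLeftRightMap_eq_sum R B t'
    have key (i : ι) : ∑ l, f i (c l) • d l = 0 := by
      simp_rw [Subring.smul_def, hf, smul_eq_mul, Finset.sum_mul]
      rw [Finset.sum_comm]
      refine Finset.sum_eq_zero fun j _ ↦ ?_
      have := hcd (b i j)
      rw [ht', LinearMap.zero_apply] at this
      simp_rw [mul_assoc, ← Finset.mul_sum, ← mul_assoc]
      rw [← this, mul_zero]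
    calc ∑ l, c l ⊗ₜ[R] MulOpposite.op (d l)
        = ∑ l, ∑ i, x i ⊗ₜ[R] MulOpposite.op (f i (c l) • d l) := by
          refine Finset.sum_congr rfl fun l _ ↦ ?_
          conv_lhs => rw [← hx' (c l)]
          simp_rw [TensorProduct.sum_tmul, TensorProduct.smul_tmul, MulOpposite.op_smul]
      _ = 0 := by
          rw [Finset.sum_comm]
          simp_rw [← TensorProduct.tmul_sum, ← Finset.op_sum, key]
          simp
  · intro φ
    refine ⟨∑ i, ∑ j, a i j ⊗ₜ MulOpposite.op (b i j * φ (x i)), LinearMap.ext fun y ↦ ?_⟩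
    conv_rhs => rw [← hx' y]
    simp_rw [map_sum, LinearMap.sum_apply, mulLeftRightMap_tmul, map_smul, Subring.smul_def, hf,
      smul_eq_mul, Finset.sum_mul, MulOpposite.unop_op, mul_assoc]

theorem isAzumayaOverCenter_iff {B : Type} [Ring B] :
    IsAzumayaOverCenter B ↔ HasCentralDualBasis B 1 :=
  ⟨fun h ↦ h.hasCentralDualBasis, fun h ↦ h.isAzumayaOverCenter⟩

theorem HasCentralDualBasis.of_ringEquiv {B C : Type} [Ring B] [Ring C] (e : B ≃+* C) {z : B}
    (h : HasCentralDualBasis B z) : HasCentralDualBasis C (e z) := by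
  obtain ⟨ι, hι, κ, hκ, x, a, b, hc, hx⟩ := h
  have he (i : ι) (y : C) : ∑ j, e (a i j) * y * e (b i j) = e (∑ j, a i j * e.symm y * b i j) := by
    simp
  refine ⟨ι, hι, κ, hκ, e ∘ x, fun i j ↦ e (a i j), fun i j ↦ e (b i j), fun i y ↦ ?_, fun y ↦ ?_⟩
  · rw [he, Subring.mem_center_iff]
    intro c
    apply e.symm.injective
    simpa using Subring.mem_center_iff.mp (hc i (e.symm y)) (e.symm c)
  · simp_rw [he]
    apply e.symm.injective
    simpa using hx (e.symm y)

theorem HasCentralDualBasis.pi {I : Type} [Fintype I] {B : I → Type}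
    [∀ i, Ring (B i)] (h : ∀ i, HasCentralDualBasis (B i) 1) :
    HasCentralDualBasis (∀ i, B i) 1 := by
  classical
  choose ι hι κ hκ x a b hc hx using h
  have hs (p : Σ i, ι i) (y : ∀ i, B i) :
      ∑ j, (Pi.single p.1 (a p.1 p.2 j) : ∀ i, B i) * y * Pi.single p.1 (b p.1 p.2 j) =
        Pi.single p.1 (∑ j, a p.1 p.2 j * y p.1 * b p.1 p.2 j) := by
    simp only [← Pi.single_mul_left, Pi.single_eq_same]
    exact (map_sum (AddMonoidHom.single B p.1) _ _).symm
  refine ⟨Σ i, ι i, inferInstance, fun p ↦ κ p.1 p.2, fun p ↦ hκ p.1 p.2,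
    fun p ↦ Pi.single p.1 (x p.1 p.2), fun p j ↦ Pi.single p.1 (a p.1 p.2 j),
    fun p j ↦ Pi.single p.1 (b p.1 p.2 j), fun p y ↦ ?_, fun y ↦ ?_⟩
  · rw [hs, Subring.mem_center_iff]
    intro c
    rw [← Pi.single_mul_left, ← Pi.single_mul_right,
      Subring.mem_center_iff.mp (hc p.1 p.2 (y p.1)) (c p.1)]
  · simp_rw [hs, Fintype.sum_sigma, ← Pi.single_mul]
    conv_rhs => rw [one_mul, ← Finset.univ_sum_single y]
    refine Finset.sum_congr rfl fun i _ ↦ ?_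
    conv_rhs => rw [← one_mul (y i), ← hx i (y i)]
    exact (map_sum (AddMonoidHom.single B i) _ _).symm

section SimpleRing

attribute [local instance] TensorProduct.Algebra.module

theorem mulLeftRightMap_apply_eq_smul (R B : Type) [CommRing R] [Ring B] [Algebra R B]
    (t : B ⊗[R] Bᵐᵒᵖ) (y : B) : mulLeftRightMap R B t y = t • y := by
  induction t with
  | zero => exact (zero_smul (B ⊗[R] Bᵐᵒᵖ) y).symm
  | add s t hs ht => rw [map_add, LinearMap.add_apply, hs, ht, add_smul]
  | tmul a b =>
    rw [mulLeftRightMap_tmul, TensorProduct.Algebra.smul_def, MulOpposite.smul_eq_mul_unop,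
      smul_eq_mul, mul_assoc]

theorem isSimpleModule_tensorProduct_op (R B : Type) [CommRing R] [Ring B] [IsSimpleRing B]
    [Algebra R B] : IsSimpleModule (B ⊗[R] Bᵐᵒᵖ) B where
  exists_pair_ne := ⟨⊥, ⊤, bot_ne_top⟩
  eq_bot_or_eq_top N := by
    have hl (a : B) {y : B} (hy : y ∈ N) : a * y ∈ N := by
      simpa [← mulLeftRightMap_apply_eq_smul, mulLeftRightMap_tmul] using
        N.smul_mem (a ⊗ₜ[R] (1 : Bᵐᵒᵖ)) hy
    have hr (a : B) {y : B} (hy : y ∈ N) : y * a ∈ N := by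
      simpa [← mulLeftRightMap_apply_eq_smul, mulLeftRightMap_tmul] using
        N.smul_mem ((1 : B) ⊗ₜ[R] MulOpposite.op a) hy
    let I : TwoSidedIdeal B := .mk' N N.zero_mem N.add_mem N.neg_mem (hl _) (hr _)
    have hI (y : B) : y ∈ I ↔ y ∈ N := TwoSidedIdeal.mem_mk' ..
    refine (eq_bot_or_eq_top I).imp (fun h ↦ ?_) (fun h ↦ ?_)
    · ext y
      rw [← hI, h, TwoSidedIdeal.mem_bot, Submodule.mem_bot]
    · ext y
      simp [← hI, h]

theorem hasCentralDualBasis_of_isSimpleRing (K B : Type) [Field K] [Ring B] [Algebra K B]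
    [Module.Finite K B] [IsSimpleRing B] : HasCentralDualBasis B 1 := by
  classical
  let R := Subring.center B
  let : Field R := (IsSimpleRing.isField_center B).toField
  let : Algebra K R := RingHom.toAlgebra
    ((algebraMap K B).codRestrict R fun r ↦ Subring.mem_center_iff.mpr fun b ↦
      (Algebra.commutes r b).symm)
  have : IsScalarTower K R B := .of_algebraMap_eq fun _ ↦ rfl
  have : Module.Finite R B := .of_restrictScalars_finite K R B
  have := isSimpleModule_tensorProduct_op R B
  let v := Module.finBasis R B
  have hφ (i : Fin (Module.finrank R B)) (e : Module.End (B ⊗[R] Bᵐᵒᵖ) B) (y : B) :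
      (v.repr (e y) i : B) = e (v.repr y i : B) := by
    have hl (y : B) : e y = y * e 1 := by
      simpa [← mulLeftRightMap_apply_eq_smul, mulLeftRightMap_tmul] using
        e.map_smul (y ⊗ₜ[R] (1 : Bᵐᵒᵖ)) 1
    have hr (y : B) : e y = e 1 * y := by
      simpa [← mulLeftRightMap_apply_eq_smul, mulLeftRightMap_tmul] using
        e.map_smul ((1 : B) ⊗ₜ[R] MulOpposite.op y) 1
    let c : R := ⟨e 1, Subring.mem_center_iff.mpr fun y ↦ (hl y).symm.trans (hr y)⟩
    have hy (y : B) : e y = c • y := hr y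
    rw [hy, hy, map_smul]
    rfl
  let φ (i) : Module.End (Module.End (B ⊗[R] Bᵐᵒᵖ) B) B :=
    { toFun y := (v.repr y i : B)
      map_add' y z := by simp
      map_smul' e y := hφ i e y }
  choose t ht using fun i ↦ jacobson_density (φ i) (Finset.univ.image v)
  refine hasCentralDualBasis_of_mulLeftRightMap v (fun i y ↦ v.repr y i) (fun y ↦ v.sum_repr y) t
    fun i y ↦ ?_
  suffices mulLeftRightMap R B (t i) =
      Algebra.linearMap R B ∘ₗ v.coord i from LinearMap.congr_fun this y
  refine v.ext fun j ↦ ?_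
  rw [mulLeftRightMap_apply_eq_smul, ← ht i (v j) (by simp)]
  rfl

end SimpleRing

theorem hasCentralDualBasis_of_isSemisimpleRing (K B : Type) [Field K] [Ring B] [Algebra K B]
    [Module.Finite K B] [IsSemisimpleRing B] : HasCentralDualBasis B 1 := by
  obtain ⟨n, D, d, _, _, _, _, ⟨e⟩⟩ :=
    IsSemisimpleRing.exists_algEquiv_pi_matrix_divisionRing_finite K B
  have := HasCentralDualBasis.pi fun i ↦
    hasCentralDualBasis_of_isSimpleRing K (Matrix (Fin (d i)) (Fin (d i)) (D i))
  simpa using this.of_ringEquiv e.symm.toRingEquiv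

section Localization

variable {k A B : Type} [CommRing k] [Ring A] [Algebra k A] [Ring B] [Algebra k B]

theorem exists_smul_eq_zero_of_isLocalizedModule [IsNoetherianRing k] [Module.Finite k A]
    (S : Submonoid k) (f : A →ₗ[k] B) [IsLocalizedModule S f] :
    ∃ t ∈ S, ∀ a, f a = 0 → t • a = 0 := by
  classical
  obtain ⟨s, hs⟩ := IsNoetherian.noetherian (LinearMap.ker f)
  have h (a : s) : ∃ t : S, t • (a : A) = 0 := by
    rw [← IsLocalizedModule.eq_zero_iff S f, ← LinearMap.mem_ker, ← hs]
    exact Submodule.subset_span a.2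
  choose t ht using h
  refine ⟨∏ a, (t a : k), S.prod_mem fun a _ ↦ (t a).2, fun a ha ↦ ?_⟩
  rw [← LinearMap.mem_ker, ← hs] at ha
  induction ha using Submodule.span_induction with
  | zero => simp
  | add x y _ _ hx hy => rw [smul_add, hx, hy, add_zero]
  | smul r x _ hx => rw [smul_comm, hx, smul_zero]
  | mem x hx =>
    rw [← Finset.prod_erase_mul _ _ (Finset.mem_univ ⟨x, hx⟩), mul_smul]
    exact (congrArg _ (ht ⟨x, hx⟩)).trans (smul_zero _)

theorem exists_hasCentralDualBasis_of_isLocalizedModule [IsNoetherianRing k] [Module.Finite k A]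
    (S : Submonoid k) (f : A →ₐ[k] B) [IsLocalizedModule S f.toLinearMap]
    (h : HasCentralDualBasis B 1) : ∃ u ∈ S, HasCentralDualBasis A (algebraMap k A u) := by
  obtain ⟨ι, hι, κ, hκ, x, a, b, hc, hx⟩ := h
  obtain ⟨t, htS, ht⟩ := exists_smul_eq_zero_of_isLocalizedModule S f.toLinearMap
  obtain ⟨s₁, h₁⟩ := IsLocalizedModule.exist_integer_multiples_of_finite S f.toLinearMap x
  obtain ⟨s₂, h₂⟩ := IsLocalizedModule.exist_integer_multiples_of_finite S f.toLinearMap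
    (fun p : Σ i, κ i ↦ a p.1 p.2)
  obtain ⟨s₃, h₃⟩ := IsLocalizedModule.exist_integer_multiples_of_finite S f.toLinearMap
    (fun p : Σ i, κ i ↦ b p.1 p.2)
  choose x' hx' using h₁
  choose a' ha' using fun i j ↦ h₂ ⟨i, j⟩
  choose b' hb' using fun i j ↦ h₃ ⟨i, j⟩
  simp only [AlgHom.toLinearMap_apply] at hx' ha' hb' ht
  have hf (i : ι) (y : A) : f (∑ j, a' i j * y * b' i j) =
      ((s₂ : k) * s₃) • ∑ j, a i j * f y * b i j := by
    simp [ha', hb', Finset.smul_sum, smul_smul, mul_comm]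
  have hs (i : ι) (y : A) : ∑ j, (t • a' i j) * y * b' i j = t • ∑ j, a' i j * y * b' i j := by
    simp [Finset.smul_sum]
  refine ⟨t * (s₁ * s₂ * s₃), S.mul_mem htS (S.mul_mem (S.mul_mem s₁.2 s₂.2) s₃.2), ι, hι, κ, hκ,
    x', fun i j ↦ t • a' i j, b', fun i y ↦ ?_, fun y ↦ ?_⟩
  · rw [hs, Subring.mem_center_iff]
    intro c
    rw [← sub_eq_zero, mul_smul_comm, smul_mul_assoc, ← smul_sub]
    apply ht
    rw [map_sub, map_mul, map_mul, hf, mul_smul_comm, smul_mul_assoc,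
      Subring.mem_center_iff.mp (hc i (f y)), sub_self]
  · simp_rw [hs, smul_mul_assoc, ← Finset.smul_sum]
    rw [← Algebra.smul_def, mul_smul, ← sub_eq_zero, ← smul_sub]
    apply ht
    rw [map_sub, map_sum, map_smul]
    simp_rw [map_mul, hf, hx', smul_mul_assoc, mul_smul_comm, smul_smul, ← Finset.smul_sum, hx,
      one_mul]
    rw [sub_eq_zero]
    congr 1
    ring

theorem HasCentralDualBasis.of_isLocalizedModule (S : Submonoid k) (f : A →ₐ[k] B)
    [IsLocalizedModule S f.toLinearMap] {u : k} (hu : u ∈ S)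
    (h : HasCentralDualBasis A (algebraMap k A u)) : HasCentralDualBasis B 1 := by
  obtain ⟨ι, hι, κ, hκ, x, a, b, hc, hx⟩ := h
  have hinj (s : S) {y z : B} (h : (s : k) • y = (s : k) • z) : y = z :=
    IsLocalizedModule.smul_injective f.toLinearMap s h
  have hsurj (y : B) : ∃ (s : S) (y' : A), (s : k) • y = f y' := by
    obtain ⟨⟨y', s⟩, h⟩ := IsLocalizedModule.surj S f.toLinearMap y
    exact ⟨s, y', h⟩
  obtain ⟨v, hv⟩ : ∃ v : B, u • v = 1 :=
    ((Module.End.isUnit_iff _).mp (IsLocalizedModule.map_units f.toLinearMap ⟨u, hu⟩)).2 1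
  refine ⟨ι, hι, κ, hκ, fun i ↦ f (x i) * v, fun i j ↦ f (a i j), fun i j ↦ f (b i j),
    fun i y ↦ Subring.mem_center_iff.mpr fun c ↦ ?_, fun y ↦ ?_⟩
  · obtain ⟨s, y', hy⟩ := hsurj y
    obtain ⟨r, c', hr⟩ := hsurj c
    have hs : (s : k) • ∑ j, f (a i j) * y * f (b i j) = f (∑ j, a i j * y' * b i j) := by
      simp [Finset.smul_sum, ← hy]
    apply hinj s
    apply hinj r
    rw [← mul_smul_comm, ← smul_mul_assoc, hr, hs, ← smul_mul_assoc, ← mul_smul_comm, hs, hr,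
      ← map_mul, Subring.mem_center_iff.mp (hc i y'), map_mul]
  · obtain ⟨s, y', hy⟩ := hsurj y
    have key : ∑ i, (∑ j, f (a i j) * y * f (b i j)) * f (x i) = u • y := by
      apply hinj s
      rw [smul_comm, hy, ← map_smul, Algebra.smul_def u, ← hx]
      simp [Finset.smul_sum, Finset.sum_mul, ← hy]
    simp_rw [← mul_assoc, ← Finset.sum_mul]
    rw [key, smul_mul_assoc, ← mul_smul_comm, hv, mul_one, one_mul]

variable (k A)

instance isLocalizedModule_includeLeft (S : Submonoid k) :
    IsLocalizedModule S
      (Algebra.TensorProduct.includeLeft : A →ₐ[k] A ⊗[k] Localization S).toLinearMap := by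
  have := IsLocalizedModule.of_linearEquiv S (TensorProduct.mk k (Localization S) A 1)
    (TensorProduct.comm k (Localization S) A)
  exact this

theorem isAzumayaOverCenter_tensorProduct_localization_iff [IsNoetherianRing k] [Module.Finite k A]
    (S : Submonoid k) : IsAzumayaOverCenter (A ⊗[k] Localization S) ↔
      ∃ u ∈ S, HasCentralDualBasis A (algebraMap k A u) := by
  rw [isAzumayaOverCenter_iff]
  exact ⟨exists_hasCentralDualBasis_of_isLocalizedModule S Algebra.TensorProduct.includeLeft,
    fun ⟨_, hu, h⟩ ↦ h.of_isLocalizedModule S Algebra.TensorProduct.includeLeft hu⟩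

end Localization

theorem jacobson_le_jacRad (A : Type) [Ring A] : Ring.jacobson A ≤ jacRad A := by
  refine le_sInf ?_
  rintro _ ⟨V, _, _, _, rfl⟩
  exact IsSemisimpleModule.jacobson_le_annihilator A V

theorem mem_ring_jacobson_of_isNilpotent_mul {A : Type} [Ring A] {x : A}
    (h : ∀ r, IsNilpotent (r * x)) : x ∈ Ring.jacobson A := by
  rw [← Ideal.jacobson_bot, Ideal.mem_jacobson_iff]
  intro r
  obtain ⟨v, hv⟩ := (h r).isUnit_add_one.exists_left_inv
  refine ⟨v, ?_⟩
  rw [Ideal.mem_bot, sub_eq_zero, ← hv]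
  noncomm_ring

theorem isSemisimpleRing_of_jacRad_eq_bot (k A : Type) [CommRing k] [IsNoetherianRing k]
    [IsDomain k] [Ring A] [Algebra k A] [Module.Finite k A] (hA : jacRad A = ⊥) :
    IsSemisimpleRing (FractionRing k ⊗[k] A) := by
  let f : A →ₐ[k] FractionRing k ⊗[k] A := Algebra.TensorProduct.includeRight
  have : IsLocalizedModule (nonZeroDivisors k) f.toLinearMap :=
    inferInstanceAs (IsLocalizedModule _ (TensorProduct.mk k (FractionRing k) A 1))
  have : IsArtinianRing (FractionRing k ⊗[k] A) :=
    .of_finite (FractionRing k) _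
  rw [IsArtinianRing.isSemisimpleRing_iff_jacobson, eq_bot_iff]
  intro y hy
  obtain ⟨t, ht, htor⟩ := exists_smul_eq_zero_of_isLocalizedModule (nonZeroDivisors k) f.toLinearMap
  obtain ⟨⟨x, s⟩, hs⟩ := IsLocalizedModule.surj (nonZeroDivisors k) f.toLinearMap y
  obtain ⟨n, hn⟩ := IsSemiprimaryRing.isNilpotent (R := FractionRing k ⊗[k] A)
  have hx : t • x = 0 := by
    rw [← Ideal.mem_bot, ← hA]
    refine jacobson_le_jacRad A (mem_ring_jacobson_of_isNilpotent_mul fun r ↦ ⟨n + 1, ?_⟩)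
    rw [mul_smul_comm, smul_pow, pow_succ t, mul_smul, htor, smul_zero]
    have hmem : f (r * x) ∈ Ring.jacobson (FractionRing k ⊗[k] A) := by
      rw [map_mul]
      refine Ideal.mul_mem_left _ _ ?_
      change f.toLinearMap x ∈ _
      rw [← hs]
      exact Submodule.smul_of_tower_mem _ (s : k) hy
    have := Ideal.pow_mem_pow hmem n
    rw [hn] at this
    change f _ = 0
    rw [map_pow, pow_succ, show f (r * x) ^ n = 0 from this, zero_mul]
  apply IsLocalizedModule.smul_injective f.toLinearMap s
  apply IsLocalizedModule.smul_injective f.toLinearMap ⟨t, ht⟩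
  change t • s • y = t • s • (0 : FractionRing k ⊗[k] A)
  rw [hs, smul_zero, smul_zero, ← map_smul, hx, map_zero]

theorem exists_ne_zero_hasCentralDualBasis (k A : Type) [CommRing k] [IsNoetherianRing k]
    [IsDomain k] [Ring A] [Algebra k A] [Module.Finite k A] (hA : jacRad A = ⊥) :
    ∃ u : k, u ≠ 0 ∧ HasCentralDualBasis A (algebraMap k A u) := by
  have := isSemisimpleRing_of_jacRad_eq_bot k A hA
  let f : A →ₐ[k] FractionRing k ⊗[k] A := Algebra.TensorProduct.includeRight
  have : IsLocalizedModule (nonZeroDivisors k) f.toLinearMap :=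
    inferInstanceAs (IsLocalizedModule _ (TensorProduct.mk k (FractionRing k) A 1))
  obtain ⟨u, hu, h⟩ := exists_hasCentralDualBasis_of_isLocalizedModule (nonZeroDivisors k) f
    (hasCentralDualBasis_of_isSemisimpleRing (FractionRing k) _)
  exact ⟨u, nonZeroDivisors.ne_zero hu, h⟩

theorem mem_azumayaLocus_iff {k A : Type} [CommRing k] [IsNoetherianRing k] [Ring A] [Algebra k A]
    [Module.Finite k A] {p : MaximalSpectrum k} :
    p ∈ azumayaLocus k A ↔ ∃ u ∉ p.asIdeal, HasCentralDualBasis A (algebraMap k A u) :=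
  isAzumayaOverCenter_tensorProduct_localization_iff k A p.asIdeal.primeCompl

/-- Lemma (lemma.Stwo): if `A` is a unital, semi-primitive finite type algebra over an
integral domain `k`, then the set of maximal ideals `p` of `k` at which the
localization `A_p = A ⊗_k k_p` is an Azumaya algebra over its center is open and dense
in `Max(k)` with the Zariski topology. -/
theorem azumaya_locus_open_dense
    (k : Type) [CommRing k] [Algebra ℂ k] [Algebra.FiniteType ℂ k] [IsDomain k]
    (A : Type) [Ring A] [Algebra k A] [Module.Finite k A]
    (hA : jacRad A = ⊥) :
    IsOpen (azumayaLocus k A) ∧ Dense (azumayaLocus k A) := by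
  have : IsNoetherianRing k := Algebra.FiniteType.isNoetherianRing ℂ k
  have : IsJacobsonRing k := isJacobsonRing_of_finiteType (A := ℂ)
  have hopen (u : k) : IsOpen {p : MaximalSpectrum k | u ∉ p.asIdeal} :=
    (PrimeSpectrum.isOpen_basicOpen (a := u)).preimage MaximalSpectrum.toPrimeSpectrum_continuous
  refine ⟨isOpen_iff_forall_mem_open.mpr fun p hp ↦ ?_, dense_iff_inter_open.mpr ?_⟩
  · obtain ⟨u, hup, hu⟩ := mem_azumayaLocus_iff.mp hp
    exact ⟨_, fun q hq ↦ mem_azumayaLocus_iff.mpr ⟨u, hq, hu⟩, hopen u, hup⟩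
  · rintro _ ⟨U, hU, rfl⟩ ⟨p, hp⟩
    obtain ⟨u, hu0, hu⟩ := exists_ne_zero_hasCentralDualBasis k A hA
    obtain ⟨_, ⟨g, rfl⟩, hpg, hgU⟩ :=
      PrimeSpectrum.isTopologicalBasis_basic_opens.exists_subset_of_mem_open hp hU
    have hg0 : g ≠ 0 := by
      rintro rfl
      exact hpg (zero_mem _)
    have hjac : g * u ∉ (⊥ : Ideal k).jacobson := by
      rw [IsJacobsonRing.out ‹_› (Ideal.isRadical_bot)]
      exact mul_ne_zero hg0 hu0
    simp only [Ideal.jacobson, Ideal.mem_sInf, not_forall] at hjac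
    obtain ⟨m, ⟨-, hm⟩, hgu⟩ := hjac
    exact ⟨⟨m, hm⟩, hgU fun h ↦ hgu (m.mul_mem_right u h),
      mem_azumayaLocus_iff.mpr ⟨u, fun h ↦ hgu (m.mul_mem_left g h), hu⟩⟩
end

section
/- Let k be a finitely generated commutative ℂ-algebra, let L and J be unital finite type k-algebras, and let φ: L → J be a k-algebra homomorphism (k-linear and multiplicative, not necessarily unital). If P is a primitive ideal of L and P' is a primitive ideal of J with φ⁻¹(P') ⊆ P, then the central characters agree: the preimage of P under the structure map k → L equals the preimage of P' under the structure map k → J (as maximal ideals of k). -/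
/-- A primitive ideal of a unital ring is proper. -/
theorem IsPrimitiveIdeal.one_notMem {A : Type} [Ring A] {P : Ideal A}
    (hP : IsPrimitiveIdeal A P) : (1 : A) ∉ P := by
  obtain ⟨V, _, _, _, rfl⟩ := hP
  intro h
  have := IsSimpleModule.nontrivial A V
  obtain ⟨v, hv⟩ := exists_ne (0 : V)
  exact hv (by simpa using Module.mem_annihilator.mp h v)

/-- The central character of a primitive ideal of a module-finite algebra is a
maximal ideal of the base ring. -/
theorem IsPrimitiveIdeal.isMaximal_comap_algebraMap {k A : Type} [CommRing k] [Ring A]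
    [Algebra k A] [Module.Finite k A] {P : Ideal A} (hP : IsPrimitiveIdeal A P) :
    (P.comap (algebraMap k A)).IsMaximal := by
  refine Ideal.isMaximal_iff.mpr ⟨by simpa using hP.one_notMem, ?_⟩
  obtain ⟨V, _, _, _, rfl⟩ := hP
  let _ : Module k V := Module.compHom V (algebraMap k A)
  have smul_def (x : k) (v : V) : x • v = algebraMap k A x • v := rfl
  have : IsScalarTower k A V :=
    ⟨fun x a v => by rw [smul_def, Algebra.smul_def, mul_smul]⟩
  have : Module.Finite k V := Module.Finite.trans A V
  intro I x hI hx hxI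
  let f : V →ₗ[A] V :=
    { toFun := fun v => x • v
      map_add' := smul_add x
      map_smul' := fun a v => by
        simp only [smul_def, ← mul_smul, Algebra.commutes, RingHom.id_apply] }
  have hf : f ≠ 0 := fun h0 =>
    hx (Module.mem_annihilator.mpr fun v => LinearMap.congr_fun h0 v)
  have hsurj : Function.Surjective f := LinearMap.surjective_of_ne_zero hf
  have hle : (⊤ : Submodule k V) ≤ Ideal.span {x} • (⊤ : Submodule k V) := by
    intro v _
    obtain ⟨w, rfl⟩ := hsurj v
    exact Submodule.smul_mem_smul (Ideal.mem_span_singleton_self x) Submodule.mem_top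
  obtain ⟨r, hr, hr0⟩ := Submodule.exists_sub_one_mem_and_smul_eq_zero_of_fg_of_le_smul
    (Ideal.span {x}) ⊤ Module.Finite.fg_top hle
  have hrI : r ∈ I := hI (Module.mem_annihilator.mpr fun v => hr0 v Submodule.mem_top)
  have hr1 : r - 1 ∈ I := (Ideal.span_singleton_le_iff_mem I).mpr hxI hr
  simpa using I.sub_mem hrI hr1

/-- Lemma (lemma.eq.cc): if `P` is a primitive ideal of `L`, `P'` a primitive ideal of
`J`, and `φ⁻¹(P') ⊆ P` for a `k`-linear (not necessarily unital) algebra morphism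
`φ : L → J`, then `P` and `P'` have the same central character in `Max(k)`. -/
theorem central_characters_agree
    (k : Type) [CommRing k] [Algebra ℂ k] [Algebra.FiniteType ℂ k]
    (L J : Type) [Ring L] [Ring J] [Algebra k L] [Algebra k J]
    [Module.Finite k L] [Module.Finite k J]
    (φ : L →ₙₐ[k] J)
    (P : Ideal L) (hP : IsPrimitiveIdeal L P)
    (P' : Ideal J) (hP' : IsPrimitiveIdeal J P')
    (h : (⇑φ) ⁻¹' (P' : Set J) ⊆ (P : Set L)) :
    P.comap (algebraMap k L) = P'.comap (algebraMap k J) := by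
  refine hP'.isMaximal_comap_algebraMap.eq_of_le ?_ ?_ |>.symm
  · exact (Ideal.ne_top_iff_one _).mpr (by simpa using hP.one_notMem)
  · intro x hx
    refine h ?_
    change φ (algebraMap k L x) ∈ P'
    rw [Algebra.algebraMap_eq_smul_one, map_smul, Algebra.smul_def, Algebra.commutes]
    exact P'.mul_mem_left _ hx
end

section
/- Let k be a finitely generated commutative ℂ-algebra, let L, J, A be unital finite type k-algebras, and let φ: L → J and ψ: J → A be k-linear algebra homomorphisms. For a k-linear algebra homomorphism θ: B → C set R_θ := {(P',P) ∈ Prim(C) × Prim(B) : θ⁻¹(P') ⊆ P}. Then R_{ψ∘φ} = R_ψ ∘ R_φ; that is, for primitive ideals P'' of A and P of L, one has (ψ∘φ)⁻¹(P'') ⊆ P if and only if there exists a primitive ideal P' of J with ψ⁻¹(P'') ⊆ P' and φ⁻¹(P') ⊆ P. -/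
theorem IsPrimitiveIdeal.subset_or_subset_of_mul_mem {A : Type} [Ring A] {P : Ideal A}
    (hP : IsPrimitiveIdeal A P) {X Y : Set A} (hY : ∀ a, ∀ y ∈ Y, a * y ∈ Y)
    (hXY : ∀ x ∈ X, ∀ y ∈ Y, x * y ∈ P) : X ⊆ P ∨ Y ⊆ P := by
  obtain ⟨V, _, _, hV, rfl⟩ := hP
  by_contra! ⟨hX, hY'⟩
  obtain ⟨y, hy, hyP⟩ := Set.not_subset.mp hY'
  obtain ⟨v, hv⟩ : ∃ v : V, y • v ≠ 0 := by
    simpa [Module.mem_annihilator] using hyP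
  refine hX fun x hx ↦ Module.mem_annihilator.mpr fun w ↦ ?_
  obtain ⟨a, rfl⟩ := IsSimpleModule.toSpanSingleton_surjective A hv w
  simpa [mul_smul] using Module.mem_annihilator.mp (hXY x hx _ (hY a y hy)) v

theorem IsPrimitiveIdeal.isTwoSided {A : Type} [Ring A] {P : Ideal A}
    (hP : IsPrimitiveIdeal A P) : P.IsTwoSided := by
  obtain ⟨V, _, _, -, rfl⟩ := hP
  infer_instance

/-- A finite module killed by a maximal ideal of the base ring has finite length, over any
algebra acting compatibly. -/
theorem isFiniteLength_of_isTorsionBySet_isMaximal {k J W : Type*} [CommRing k] [Ring J]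
    [Algebra k J] [AddCommGroup W] [Module k W] [Module J W] [IsScalarTower k J W]
    [Module.Finite k W] {m : Ideal k} (hm : m.IsMaximal)
    (h : Module.IsTorsionBySet k W m) : IsFiniteLength J W := by
  have : IsSemisimpleModule k W := by
    let _ := h.module
    let _ := Ideal.Quotient.field m
    exact h.isSemisimpleModule_iff.mp inferInstance
  have : IsNoetherian k W := (IsSemisimpleModule.finite_tfae.out 0 1).mp ‹_›
  exact isFiniteLength_iff_isNoetherian_isArtinian.mpr
    ⟨isNoetherian_of_tower k ‹_›, isArtinian_of_tower k inferInstance⟩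

/-- Primitive ideals over the annihilator of a module of finite length, lying over a given
primitive ideal. -/
theorem IsFiniteLength.exists_isPrimitiveIdeal {J W L : Type} [Ring J] [Ring L]
    [AddCommGroup W] [Module J W] (hW : IsFiniteLength J W) (φ : L →ₙ+* J) {P : Ideal L}
    (hP : IsPrimitiveIdeal L P) (h : φ ⁻¹' (Module.annihilator J W : Set J) ⊆ P) :
    ∃ P' : Ideal J, IsPrimitiveIdeal J P' ∧ Module.annihilator J W ≤ P' ∧
      φ ⁻¹' (P' : Set J) ⊆ P := by
  induction hW with
  | of_subsingleton =>
    exact absurd (h (Module.mem_annihilator.mpr fun _ ↦ Subsingleton.elim _ _)) hP.one_notMem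
  | @of_simple_quotient M _ _ N _ _ ih =>
    have hN : Module.annihilator J M ≤ Module.annihilator J N :=
      N.subtype.annihilator_le_of_injective N.injective_subtype
    have hQ : Module.annihilator J M ≤ Module.annihilator J (M ⧸ N) :=
      N.mkQ.annihilator_le_of_surjective N.mkQ_surjective
    have hmul : φ ⁻¹' (Module.annihilator J N : Set J) ⊆ P ∨
        φ ⁻¹' (Module.annihilator J (M ⧸ N) : Set J) ⊆ P := by
      refine hP.subset_or_subset_of_mul_mem (fun a y hy ↦ ?_) fun x hx y hy ↦ h ?_
      · rw [Set.mem_preimage, map_mul]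
        exact Ideal.mul_mem_left _ _ hy
      · rw [Set.mem_preimage, map_mul]
        refine Module.mem_annihilator.mpr fun w ↦ ?_
        have hyw : φ y • w ∈ N := by
          simpa using (Submodule.Quotient.mk_eq_zero N).mp
            (Module.mem_annihilator.mp hy (N.mkQ w))
        rw [mul_smul]
        exact congrArg Subtype.val (Module.mem_annihilator.mp hx ⟨_, hyw⟩)
    rcases hmul with hmul | hmul
    · obtain ⟨P', hP', hle, hsub⟩ := ih hmul
      exact ⟨P', hP', hN.trans hle, hsub⟩
    · exact ⟨_, ⟨M ⧸ N, _, _, inferInstance, rfl⟩, hQ, hmul⟩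

/-- Lemma (lemma.comp): `R_{ψ∘φ} = R_ψ ∘ R_φ` for morphisms of unital finite type
`k`-algebras. -/
theorem relation_of_composition
    (k : Type) [CommRing k] [Algebra ℂ k] [Algebra.FiniteType ℂ k]
    (L J A : Type) [Ring L] [Ring J] [Ring A]
    [Algebra k L] [Algebra k J] [Algebra k A]
    [Module.Finite k L] [Module.Finite k J] [Module.Finite k A]
    (φ : L →ₙₐ[k] J) (ψ : J →ₙₐ[k] A)
    (P'' : Ideal A) (hP'' : IsPrimitiveIdeal A P'')
    (P : Ideal L) (hP : IsPrimitiveIdeal L P) :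
    ((⇑(ψ.comp φ)) ⁻¹' (P'' : Set A) ⊆ (P : Set L)) ↔
      ∃ P' : Ideal J, IsPrimitiveIdeal J P' ∧
        ((⇑ψ) ⁻¹' (P'' : Set A) ⊆ (P' : Set J)) ∧
        ((⇑φ) ⁻¹' (P' : Set J) ⊆ (P : Set L)) := by
  constructor
  · intro h
    have := hP''.isTwoSided
    let I : Ideal J :=
      { carrier := ψ ⁻¹' (P'' : Set A)
        add_mem' := fun {a b} ha hb ↦ by
          rw [Set.mem_preimage, map_add]
          exact P''.add_mem ha hb
        zero_mem' := by simp
        smul_mem' := fun a b hb ↦ by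
          rw [smul_eq_mul, Set.mem_preimage, map_mul]
          exact P''.mul_mem_left _ hb }
    have : I.IsTwoSided := ⟨fun {a} b ha ↦ by
      change ψ (a * b) ∈ P''
      rw [map_mul]
      exact P''.mul_mem_right _ ha⟩
    have htors : Module.IsTorsionBySet k (J ⧸ I) (P''.comap (algebraMap k A)) := by
      rintro w ⟨x, hx⟩
      obtain ⟨j, rfl⟩ := Submodule.Quotient.mk_surjective I w
      change Submodule.Quotient.mk (x • j) = 0
      refine (Submodule.Quotient.mk_eq_zero I).mpr ?_
      change ψ (x • j) ∈ P''
      rw [map_smul, Algebra.smul_def]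
      exact P''.mul_mem_right _ hx
    have : Module.Finite k (J ⧸ I) :=
      .of_surjective (I.mkQ.restrictScalars k) I.mkQ_surjective
    have hlen : IsFiniteLength J (J ⧸ I) :=
      isFiniteLength_of_isTorsionBySet_isMaximal hP''.isMaximal_comap_algebraMap htors
    have hann : Module.annihilator J (J ⧸ I) = I := Ideal.annihilator_quotient
    obtain ⟨P', hP', hle, hsub⟩ := hlen.exists_isPrimitiveIdeal (φ : L →ₙ+* J) hP
      (by rw [hann]; exact h)
    rw [hann] at hle
    exact ⟨P', hP', hle, hsub⟩
  · rintro ⟨P', -, hψ, hφ⟩ l hl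
    exact hφ (hψ hl)
end

section
/- Let k be a finitely generated commutative ℂ-algebra, let L, J, A be unital finite type k-algebras, and let φ: L → J and ψ: J → A be k-linear algebra homomorphisms. If two of the three morphisms φ, ψ, ψ∘φ are spectrum preserving, then so is the third, and in that case (ψ∘φ)* = φ* ∘ ψ* as bijections Prim(A) → Prim(L). -/
/-- The annihilator in a central subring of a finite simple module is maximal. -/
theorem isMaximal_annihilator_of_isSimpleModule {k A V : Type*} [CommRing k] [Ring A]
    [Algebra k A] [AddCommGroup V] [Module A V] [Module k V] [IsScalarTower k A V]
    [IsSimpleModule A V] [Module.Finite k V] : (Module.annihilator k V).IsMaximal := by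
  have : Nontrivial V := IsSimpleModule.nontrivial A V
  rw [Ideal.isMaximal_iff]
  refine ⟨fun h ↦ ?_, fun I a hI ha haI ↦ ?_⟩
  · obtain ⟨v, hv⟩ := exists_ne (0 : V)
    exact hv (by simpa using Module.mem_annihilator.1 h v)
  · let f : V →ₗ[A] V :=
      { toFun := fun v ↦ a • v
        map_add' := smul_add a
        map_smul' := fun b v ↦ by
          rw [RingHom.id_apply, ← algebraMap_smul A a, ← algebraMap_smul A a, smul_smul,
            smul_smul, Algebra.commutes] }
    have hf : f ≠ 0 := fun h ↦ ha (Module.mem_annihilator.2 fun v ↦ LinearMap.congr_fun h v)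
    have hsurj := LinearMap.surjective_of_ne_zero hf
    obtain ⟨r, hr, hr'⟩ := Submodule.exists_sub_one_mem_and_smul_eq_zero_of_fg_of_le_smul I
      (⊤ : Submodule k V) Module.Finite.fg_top (fun v _ ↦ by
        obtain ⟨w, rfl⟩ := hsurj v
        exact Submodule.smul_mem_smul haI trivial)
    have : r ∈ I := hI (Module.mem_annihilator.2 fun v ↦ hr' v trivial)
    simpa using I.sub_mem this hr

/-- A module finite over `k` whose annihilator is maximal has finite length. -/
theorem isFiniteLength_of_isMaximal_annihilator {k V : Type*} [CommRing k] [AddCommGroup V]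
    [Module k V] [Module.Finite k V] (h : (Module.annihilator k V).IsMaximal) :
    IsFiniteLength k V := by
  let F := k ⧸ Module.annihilator k V
  let _ : Field F := Ideal.Quotient.field _
  let _ : Module F V := Module.quotientAnnihilator
  have : IsScalarTower k F V :=
    Module.IsTorsionBySet.isScalarTower (Module.isTorsionBySet_annihilator k V)
  have : Module.Finite F V := Module.Finite.of_restrictScalars_finite k F V
  let l : V →ₛₗ[Ideal.Quotient.mk (Module.annihilator k V)] V :=
    { toFun := id
      map_add' := fun _ _ ↦ rfl
      map_smul' := fun a v ↦ (algebraMap_smul F a v).symm }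
  have hl : Function.Bijective l := Function.bijective_id
  rw [isFiniteLength_iff_isNoetherian_isArtinian, l.isNoetherian_iff_of_bijective hl,
    l.isArtinian_iff_of_bijective hl]
  exact ⟨inferInstanceAs (IsNoetherian F V), inferInstanceAs (IsArtinian F V)⟩

/-- Primitive ideals are prime, in elementwise form. -/
theorem IsPrimitiveIdeal.exists_mul_mul_notMem {L : Type} [Ring L] {Q : Ideal L}
    (hQ : IsPrimitiveIdeal L Q) {a b : L} (ha : a ∉ Q) (hb : b ∉ Q) : ∃ x, b * x * a ∉ Q := by
  obtain ⟨S, _, _, _, rfl⟩ := hQ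
  simp only [Module.mem_annihilator, not_forall] at ha hb ⊢
  obtain ⟨t, ht⟩ := ha
  obtain ⟨s, hs⟩ := hb
  obtain ⟨x, hx⟩ := IsSimpleModule.toSpanSingleton_surjective L ht s
  refine ⟨x, t, ?_⟩
  rw [mul_smul, mul_smul]
  rwa [← hx] at hs

/-- A primitive ideal is proper. -/
theorem IsPrimitiveIdeal.one_notMem_s8 {L : Type} [Ring L] {Q : Ideal L}
    (hQ : IsPrimitiveIdeal L Q) : (1 : L) ∉ Q := by
  obtain ⟨S, _, _, _, rfl⟩ := hQ
  have := IsSimpleModule.nontrivial L S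
  obtain ⟨s, hs⟩ := exists_ne (0 : S)
  exact fun h ↦ hs (by simpa using Module.mem_annihilator.1 h s)

/-- If the preimage of the annihilator of a finite length module lies in a primitive ideal `Q`,
then so does the preimage of some primitive ideal containing this annihilator. -/
theorem exists_isPrimitiveIdeal_preimage_subset {k L J W : Type} [CommRing k] [Ring L] [Ring J]
    [Algebra k L] [Algebra k J] (φ : L →ₙₐ[k] J) {Q : Ideal L} (hQ : IsPrimitiveIdeal L Q)
    [AddCommGroup W] [Module J W] (hW : IsFiniteLength J W)
    (h : ⇑φ ⁻¹' (Module.annihilator J W : Set J) ⊆ Q) :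
    ∃ P : Ideal J, IsPrimitiveIdeal J P ∧ Module.annihilator J W ≤ P ∧
      ⇑φ ⁻¹' (P : Set J) ⊆ Q := by
  induction hW with
  | of_subsingleton =>
    exact (hQ.one_notMem_s8 (h (Module.mem_annihilator.2 fun _ ↦ Subsingleton.elim _ _))).elim
  | @of_simple_quotient M _ _ N hs hN ih =>
    by_cases h₁ : ⇑φ ⁻¹' (Module.annihilator J (M ⧸ N) : Set J) ⊆ Q
    · exact ⟨_, ⟨M ⧸ N, _, _, hs, rfl⟩, N.mkQ.annihilator_le_of_surjective N.mkQ_surjective, h₁⟩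
    by_cases h₂ : ⇑φ ⁻¹' (Module.annihilator J N : Set J) ⊆ Q
    · obtain ⟨P, hP, hNP, hPQ⟩ := ih h₂
      exact ⟨P, hP,
        (N.subtype.annihilator_le_of_injective N.subtype_injective).trans hNP, hPQ⟩
    obtain ⟨a, ha, haQ⟩ := Set.not_subset.1 h₁
    obtain ⟨b, hb, hbQ⟩ := Set.not_subset.1 h₂
    obtain ⟨x, hx⟩ := hQ.exists_mul_mul_notMem haQ hbQ
    refine (hx (h (Module.mem_annihilator.2 fun m ↦ ?_))).elim
    have hm : φ a • m ∈ N := by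
      rw [← Submodule.Quotient.mk_eq_zero, Submodule.Quotient.mk_smul]
      exact Module.mem_annihilator.1 ha _
    rw [map_mul, map_mul, mul_smul, mul_smul]
    exact congrArg Subtype.val (Module.mem_annihilator.1 hb ⟨_, N.smul_mem (φ x) hm⟩)

/-- The preimage of a primitive ideal under a (not necessarily unital) morphism is the annihilator
of a finite length module. -/
theorem IsPrimitiveIdeal.exists_isFiniteLength_preimage_eq {k J A : Type} [CommRing k] [Ring J]
    [Ring A] [Algebra k J] [Algebra k A] [Module.Finite k A] (ψ : J →ₙₐ[k] A) {P : Ideal A}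
    (hP : IsPrimitiveIdeal A P) :
    ∃ (W : Type) (_ : AddCommGroup W) (_ : Module J W), IsFiniteLength J W ∧
      ⇑ψ ⁻¹' (P : Set A) = Module.annihilator J W := by
  obtain ⟨V, _, _, _, rfl⟩ := hP
  let _ : Module k V := Module.compHom V (algebraMap k A)
  have : IsScalarTower k A V := IsScalarTower.of_algebraMap_smul fun _ _ ↦ rfl
  have : Module.Finite k V := Module.Finite.trans A V
  have hV : IsFiniteLength k V :=
    isFiniteLength_of_isMaximal_annihilator (isMaximal_annihilator_of_isSimpleModule (A := A))
  let W := LinearMap.range (Algebra.lsmul k k V (ψ 1))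
  have hone : ∀ w : W, ψ 1 • (w : V) = w := by
    rintro ⟨_, v, rfl⟩
    simp [smul_smul, ← map_mul]
  let _ : SMul J W := ⟨fun j w ↦ ⟨ψ j • (w : V), ψ j • (w : V), by simp [smul_smul, ← map_mul]⟩⟩
  have hsmul : ∀ (j : J) (w : W), ((j • w : W) : V) = ψ j • (w : V) := fun _ _ ↦ rfl
  let _ : Module J W :=
    { one_smul := fun w ↦ Subtype.ext (hone w)
      mul_smul := fun a b w ↦ Subtype.ext (by simp [hsmul, mul_smul])
      smul_zero := fun a ↦ Subtype.ext (by simp [hsmul])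
      smul_add := fun a v w ↦ Subtype.ext (by simp [hsmul])
      add_smul := fun a b w ↦ Subtype.ext (by simp [hsmul, add_smul])
      zero_smul := fun w ↦ Subtype.ext (by simp [hsmul]) }
  have : IsScalarTower k J W := ⟨fun c j w ↦ Subtype.ext (by simp [hsmul])⟩
  refine ⟨W, _, ‹_›, ?_, ?_⟩
  · obtain ⟨_, _⟩ := isFiniteLength_iff_isNoetherian_isArtinian.1 hV
    exact isFiniteLength_iff_isNoetherian_isArtinian.2
      ⟨isNoetherian_of_tower k inferInstance, isArtinian_of_tower k inferInstance⟩
  · ext j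
    simp only [Set.mem_preimage, SetLike.mem_coe, Module.mem_annihilator]
    refine ⟨fun h w ↦ Subtype.ext (h w), fun h v ↦ ?_⟩
    have hv := congrArg Subtype.val (h ⟨ψ 1 • v, v, rfl⟩)
    rw [hsmul, smul_smul, ← map_mul, mul_one] at hv
    exact hv

/-- The relation attached to a composition is the composition of the relations. -/
theorem preimage_comp_subset_iff {k L J A : Type} [CommRing k] [Ring L] [Ring J] [Ring A]
    [Algebra k L] [Algebra k J] [Algebra k A] [Module.Finite k A] (φ : L →ₙₐ[k] J)
    (ψ : J →ₙₐ[k] A) (P : PrimSpec A) (Q : PrimSpec L) :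
    ⇑(ψ.comp φ) ⁻¹' (P.1 : Set A) ⊆ (Q.1 : Set L) ↔
      ∃ M : PrimSpec J, ⇑ψ ⁻¹' (P.1 : Set A) ⊆ (M.1 : Set J) ∧
        ⇑φ ⁻¹' (M.1 : Set J) ⊆ (Q.1 : Set L) := by
  rw [NonUnitalAlgHom.coe_comp, Set.preimage_comp]
  constructor
  · intro h
    obtain ⟨W, _, _, hW, hPW⟩ := P.2.exists_isFiniteLength_preimage_eq ψ
    rw [hPW] at h ⊢
    obtain ⟨M, hM, hWM, hMQ⟩ := exists_isPrimitiveIdeal_preimage_subset φ Q.2 hW h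
    exact ⟨⟨M, hM⟩, hWM, hMQ⟩
  · rintro ⟨M, hPM, hMQ⟩
    exact (Set.preimage_mono hPM).trans hMQ


/-- Proposition (prop.comp): if two of `φ`, `ψ`, `ψ∘φ` are spectrum preserving then so
is the third, and `(ψ∘φ)* = φ* ∘ ψ*`. -/
theorem spectrumPreserving_two_out_of_three
    (k : Type) [CommRing k] [Algebra ℂ k] [Algebra.FiniteType ℂ k]
    (L J A : Type) [Ring L] [Ring J] [Ring A]
    [Algebra k L] [Algebra k J] [Algebra k A]
    [Module.Finite k L] [Module.Finite k J] [Module.Finite k A]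
    (φ : L →ₙₐ[k] J) (ψ : J →ₙₐ[k] A) :
    ((SpectrumPreserving φ → SpectrumPreserving ψ → SpectrumPreserving (ψ.comp φ)) ∧
     (SpectrumPreserving φ → SpectrumPreserving (ψ.comp φ) → SpectrumPreserving ψ) ∧
     (SpectrumPreserving ψ → SpectrumPreserving (ψ.comp φ) → SpectrumPreserving φ)) ∧
    ∀ (fφ : PrimSpec J → PrimSpec L) (fψ : PrimSpec A → PrimSpec J)
      (fc : PrimSpec A → PrimSpec L),
      IsGraphOf φ fφ → IsGraphOf ψ fψ → IsGraphOf (ψ.comp φ) fc →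
      fc = fφ ∘ fψ := by
  have hrel := preimage_comp_subset_iff φ ψ
  refine ⟨⟨?_, ?_, ?_⟩, ?_⟩
  · rintro ⟨f, hf, hf'⟩ ⟨g, hg, hg'⟩
    refine ⟨f ∘ g, hf.comp hg, fun P Q ↦ ?_⟩
    rw [hrel]
    simp [hf', hg']
  · rintro ⟨f, hf, hf'⟩ ⟨h, hh, hh'⟩
    let e := Equiv.ofBijective f hf
    refine ⟨e.symm ∘ h, e.symm.bijective.comp hh, fun P M ↦ ?_⟩
    have := (hh' P (f M)).symm.trans (hrel P (f M))
    simp only [hf', hf.1.eq_iff, exists_eq_right] at this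
    rw [← this, Function.comp_apply, Equiv.symm_apply_eq]
    rfl
  · rintro ⟨g, hg, hg'⟩ ⟨h, hh, hh'⟩
    let e := Equiv.ofBijective g hg
    refine ⟨h ∘ e.symm, hh.comp e.symm.bijective, fun M Q ↦ ?_⟩
    obtain ⟨P, rfl⟩ := hg.2 M
    have := (hh' P Q).symm.trans (hrel P Q)
    simp only [hg', exists_eq_left'] at this
    rw [← this, Function.comp_apply, show e.symm (g P) = P from e.symm_apply_apply P]
  · rintro f g h ⟨_, hf'⟩ ⟨_, hg'⟩ ⟨_, hh'⟩
    funext P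
    exact (hh' P _).1 ((hrel P _).2 ⟨g P, (hg' P _).2 rfl, (hf' _ _).2 rfl⟩)
end

section
/- Let k be a finitely generated commutative ℂ-algebra, L and J unital finite type k-algebras, and φ: L → J a spectrum preserving k-linear algebra homomorphism. Then the kernel of φ is contained in the Jacobson radical Jac(L) of L. Moreover, an arbitrary k-linear algebra homomorphism φ: L → J is spectrum preserving if and only if ker(φ) ⊆ Jac(L) and the induced morphism L/ker(φ) → J is spectrum preserving. -/
/-- A surjective ring homomorphism pulls primitive ideals back to primitive ideals. -/
theorem IsPrimitiveIdeal.comap {A B : Type} [Ring A] [Ring B] {p : A →+* B}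
    (hp : Function.Surjective p) {Q : Ideal B} (hQ : IsPrimitiveIdeal B Q) :
    IsPrimitiveIdeal A (Ideal.comap p Q) := by
  obtain ⟨V, _, _, hV, rfl⟩ := hQ
  let := Module.compHom V p
  have : RingHomSurjective p := ⟨hp⟩
  let e : V →ₛₗ[p] V := { AddMonoidHom.id V with map_smul' := fun _ _ => rfl }
  refine ⟨V, _, inferInstance,
    (LinearMap.isSimpleModule_iff_of_bijective e Function.bijective_id).2 hV, ?_⟩
  ext x
  simp only [Ideal.mem_comap, Module.mem_annihilator]
  rfl

/-- A primitive ideal containing the kernel of a surjective ring homomorphism is the preimage of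
a primitive ideal. -/
theorem IsPrimitiveIdeal.exists_comap_eq {A B : Type} [Ring A] [Ring B] {p : A →+* B}
    (hp : Function.Surjective p) {P : Ideal A} (hP : IsPrimitiveIdeal A P)
    (hker : RingHom.ker p ≤ P) :
    ∃ Q : Ideal B, IsPrimitiveIdeal B Q ∧ Ideal.comap p Q = P := by
  obtain ⟨V, _, _, hV, rfl⟩ := hP
  let g : {g : A →+* AddMonoid.End V // RingHom.ker p ≤ RingHom.ker g} :=
    ⟨Module.toAddMonoidEnd A V, fun x hx => by
      ext v
      exact Module.mem_annihilator.1 (hker hx) v⟩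
  let : Module B V := Module.compHom V (p.liftOfSurjective hp g)
  have hsmul (a : A) (v : V) : p a • v = a • v :=
    DFunLike.congr_fun
      (p.liftOfRightInverse_comp_apply _ (Function.rightInverse_surjInv hp) g a) v
  have : RingHomSurjective p := ⟨hp⟩
  let e : V →ₛₗ[p] V := { AddMonoidHom.id V with map_smul' := fun a v => (hsmul a v).symm }
  refine ⟨Module.annihilator B V, ⟨V, _, inferInstance,
    (LinearMap.isSimpleModule_iff_of_bijective e Function.bijective_id).1 hV, rfl⟩, ?_⟩
  ext x
  simp only [Ideal.mem_comap, Module.mem_annihilator, hsmul]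

/-- The map on primitive spectra induced by a surjective ring homomorphism. -/
def PrimSpec.comap {A B : Type} [Ring A] [Ring B] (p : A →+* B) (hp : Function.Surjective p)
    (Q : PrimSpec B) : PrimSpec A :=
  ⟨Ideal.comap p Q.1, Q.2.comap hp⟩

/-- If the kernel of a surjective ring homomorphism lies in the Jacobson radical, then it
induces a bijection of primitive spectra. -/
theorem PrimSpec.comap_bijective {A B : Type} [Ring A] [Ring B] {p : A →+* B}
    (hp : Function.Surjective p) (hker : RingHom.ker p ≤ jacRad A) :
    Function.Bijective (PrimSpec.comap p hp) := by
  refine ⟨fun Q Q' h => Subtype.ext (Ideal.comap_injective_of_surjective p hp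
    (congrArg Subtype.val h)), fun P => ?_⟩
  obtain ⟨Q, hQ, h⟩ := P.2.exists_comap_eq hp (hker.trans (sInf_le P.2))
  exact ⟨⟨Q, hQ⟩, Subtype.ext h⟩

section SpectrumPreserving
variable {k L J : Type} [CommRing k] [Ring L] [Ring J] [Algebra k L] [Algebra k J]

theorem SpectrumPreserving.mem_jacRad {φ : L →ₙₐ[k] J} (h : SpectrumPreserving φ) {x : L}
    (hx : φ x = 0) : x ∈ jacRad L := by
  obtain ⟨f, hf, hgraph⟩ := h
  refine Submodule.mem_sInf.2 fun Q hQ => ?_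
  obtain ⟨P, hP⟩ := hf.surjective ⟨Q, hQ⟩
  refine (hgraph P ⟨Q, hQ⟩).2 hP ?_
  simp [hx]

/-- Spectrum preservation can be tested after factoring through a surjection whose kernel lies in
the Jacobson radical. -/
theorem spectrumPreserving_iff_of_factor {L' : Type} [Ring L'] [Algebra k L'] {φ : L →ₙₐ[k] J}
    {p : L →+* L'} {φ' : L' →ₙₐ[k] J} (hp : Function.Surjective p)
    (hker : RingHom.ker p ≤ jacRad L) (hφ : ∀ x, φ' (p x) = φ x) :
    SpectrumPreserving φ ↔ SpectrumPreserving φ' := by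
  let c : PrimSpec L' ≃ PrimSpec L := Equiv.ofBijective _ (PrimSpec.comap_bijective hp hker)
  have hrel (P : PrimSpec J) (Q : PrimSpec L') :
      φ ⁻¹' (P.1 : Set J) ⊆ ((c Q).1 : Set L) ↔ φ' ⁻¹' (P.1 : Set J) ⊆ (Q.1 : Set L') := by
    have hpre : φ ⁻¹' (P.1 : Set J) = p ⁻¹' (φ' ⁻¹' (P.1 : Set J)) := by
      ext x
      simp [hφ]
    rw [hpre]
    exact hp.preimage_subset_preimage_iff
  constructor
  · rintro ⟨f, hf, hgraph⟩
    refine ⟨c.symm ∘ f, c.symm.bijective.comp hf, fun P Q => ?_⟩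
    rw [← hrel, hgraph, Function.comp_apply, Equiv.symm_apply_eq]
  · rintro ⟨f, hf, hgraph⟩
    refine ⟨c ∘ f, c.bijective.comp hf, fun P Q => ?_⟩
    obtain ⟨Q, rfl⟩ := c.surjective Q
    rw [hrel, hgraph, Function.comp_apply, c.apply_eq_iff_eq]

end SpectrumPreserving

/-- Lemma (lemma.inj.J): the kernel of a spectrum preserving morphism is contained in
the Jacobson radical; and `φ` is spectrum preserving iff `ker(φ) ⊆ Jac(L)` and the
induced morphism `L/ker(φ) → J` (presented as `φ'` on any surjective image of `L` with
kernel `ker(φ)`) is spectrum preserving. -/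
theorem kernel_subset_jacobson_of_spectrumPreserving
    (k : Type) [CommRing k] [Algebra ℂ k] [Algebra.FiniteType ℂ k]
    (L J : Type) [Ring L] [Ring J] [Algebra k L] [Algebra k J]
    [Module.Finite k L] [Module.Finite k J]
    (φ : L →ₙₐ[k] J) :
    (SpectrumPreserving φ → ∀ x : L, φ x = 0 → x ∈ jacRad L) ∧
    ∀ (L' : Type) [Ring L'] [Algebra k L'],
      ∀ (p : L →ₐ[k] L') (φ' : L' →ₙₐ[k] J),
        Function.Surjective p →
        (∀ x : L, p x = 0 ↔ φ x = 0) →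
        (∀ x : L, φ' (p x) = φ x) →
        (SpectrumPreserving φ ↔
          ((∀ x : L, φ x = 0 → x ∈ jacRad L) ∧ SpectrumPreserving φ')) := by
  refine ⟨fun h x hx => h.mem_jacRad hx, fun L' _ _ p φ' hp hker hφ => ?_⟩
  have key (h : ∀ x : L, φ x = 0 → x ∈ jacRad L) :
      SpectrumPreserving φ ↔ SpectrumPreserving φ' :=
    spectrumPreserving_iff_of_factor (p := (p : L →+* L')) hp
      (fun x hx => h x ((hker x).1 hx)) hφ
  constructor
  · intro h
    have hjac : ∀ x : L, φ x = 0 → x ∈ jacRad L := fun x hx => h.mem_jacRad hx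
    exact ⟨hjac, (key hjac).1 h⟩
  · rintro ⟨hjac, h⟩
    exact (key hjac).2 h
end

section
/- Let k be a finitely generated commutative ℂ-algebra, L and J unital finite type k-algebras, and φ: L → J a spectrum preserving k-linear algebra homomorphism with associated bijection φ*: Prim(J) → Prim(L). Then for every two-sided ideal J' of J, the image of V(J') under φ* equals V(φ⁻¹(J')); that is, φ*({P ∈ Prim(J) : J' ⊆ P}) = {Q ∈ Prim(L) : φ⁻¹(J') ⊆ Q}. -/
section PrimitiveIdeals

variable {k L J : Type} [CommRing k] [Ring L] [Ring J] [Algebra k L] [Algebra k J]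

/-- The annihilator of a simple module is a prime two-sided ideal. -/
theorem exists_mul_mul_notMem_annihilator {V : Type} [AddCommGroup V] [Module L V]
    [IsSimpleModule L V] {a b : L} (ha : a ∉ Module.annihilator L V)
    (hb : b ∉ Module.annihilator L V) : ∃ l : L, a * l * b ∉ Module.annihilator L V := by
  simp only [Module.mem_annihilator, not_forall] at ha hb ⊢
  obtain ⟨w, hw⟩ := ha
  obtain ⟨v, hv⟩ := hb
  obtain ⟨l, rfl⟩ := IsSimpleModule.toSpanSingleton_surjective L hv w
  exact ⟨l, v, by simpa [mul_smul] using hw⟩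

/-- If the preimage of the annihilator of a module `M` of finite length lies in the annihilator
of a simple module, then so does the preimage of the annihilator of some simple subquotient
of `M`. -/
theorem IsFiniteLength.exists_isPrimitiveIdeal_s12 (φ : L →ₙₐ[k] J) {V : Type} [AddCommGroup V]
    [Module L V] [IsSimpleModule L V] {M : Type} [AddCommGroup M] [Module J M]
    (hM : IsFiniteLength J M)
    (h : ∀ x, φ x ∈ Module.annihilator J M → x ∈ Module.annihilator L V) :
    ∃ P : Ideal J, IsPrimitiveIdeal J P ∧ Module.annihilator J M ≤ P ∧
      ∀ x, φ x ∈ P → x ∈ Module.annihilator L V := by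
  induction hM with
  | of_subsingleton =>
    have := IsSimpleModule.nontrivial L V
    obtain ⟨v, hv⟩ := exists_ne (0 : V)
    refine absurd ?_ hv
    simpa using Module.mem_annihilator.mp
      (h 1 (Module.mem_annihilator.mpr fun _ ↦ Subsingleton.elim _ _)) v
  | @of_simple_quotient M _ _ N _ _ ih =>
    by_cases hN : ∀ x, φ x ∈ Module.annihilator J N → x ∈ Module.annihilator L V
    · obtain ⟨P, hP, hle, hx⟩ := ih hN
      exact ⟨P, hP, (N.subtype.annihilator_le_of_injective N.injective_subtype).trans hle, hx⟩
    · refine ⟨Module.annihilator J (M ⧸ N), ⟨M ⧸ N, _, _, inferInstance, rfl⟩,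
        N.mkQ.annihilator_le_of_surjective N.mkQ_surjective, fun b hb ↦ ?_⟩
      by_contra hbV
      push Not at hN
      obtain ⟨a, haN, haV⟩ := hN
      obtain ⟨l, hl⟩ := exists_mul_mul_notMem_annihilator haV hbV
      refine hl (h _ (Module.mem_annihilator.mpr fun m ↦ ?_))
      have hbm : φ b • m ∈ N := by
        rw [← Submodule.Quotient.mk_eq_zero, Submodule.Quotient.mk_smul]
        exact Module.mem_annihilator.mp hb _
      have := Module.mem_annihilator.mp haN ⟨φ l • φ b • m, N.smul_mem _ hbm⟩
      simpa [mul_smul] using congrArg Subtype.val this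

/-- Over a finite algebra, a simple module has a maximal ideal as central character. -/
theorem isMaximal_comap_annihilator [Module.Finite k L] (V : Type) [AddCommGroup V] [Module L V]
    [IsSimpleModule L V] :
    ((Module.annihilator L V).comap (algebraMap k L)).IsMaximal := by
  have := IsSimpleModule.nontrivial L V
  let : Module k V := Module.compHom V (algebraMap k L)
  have : IsScalarTower k L V := IsScalarTower.of_algebraMap_smul fun _ _ ↦ rfl
  have : Module.Finite k V := Module.Finite.trans L V
  rw [Ideal.isMaximal_iff]
  constructor
  · obtain ⟨v, hv⟩ := exists_ne (0 : V)
    intro h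
    rw [Ideal.mem_comap, map_one, Module.mem_annihilator] at h
    exact hv (by simpa using h v)
  · intro I c hI hc hcI
    let W : Submodule L V :=
      { carrier := {w | ∃ v : V, algebraMap k L c • v = w}
        zero_mem' := ⟨0, smul_zero _⟩
        add_mem' := by
          rintro _ _ ⟨a, rfl⟩ ⟨b, rfl⟩
          exact ⟨a + b, smul_add _ _ _⟩
        smul_mem' := by
          rintro l _ ⟨a, rfl⟩
          exact ⟨l • a, by rw [smul_smul, smul_smul, Algebra.commutes]⟩ }
    have hW : W = ⊤ := by
      refine (eq_bot_or_eq_top W).resolve_left fun hbot ↦ hc ?_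
      rw [Ideal.mem_comap, Module.mem_annihilator]
      intro v
      rw [← Submodule.mem_bot L, ← hbot]
      exact ⟨v, rfl⟩
    obtain ⟨r, hr, hr0⟩ := Submodule.exists_sub_one_mem_and_smul_eq_zero_of_fg_of_le_smul I
      (⊤ : Submodule k V) Module.Finite.fg_top (by
        intro w _
        obtain ⟨v, rfl⟩ : w ∈ W := hW ▸ Submodule.mem_top
        exact Submodule.smul_mem_smul (N := (⊤ : Submodule k V)) hcI Submodule.mem_top)
    have hrI : r ∈ I := hI (by
      rw [Ideal.mem_comap, Module.mem_annihilator]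
      exact fun v ↦ hr0 v Submodule.mem_top)
    simpa using I.sub_mem hrI hr

end PrimitiveIdeals

/-- The quotient of a Noetherian ring by a power of a maximal ideal is Artinian. -/
theorem Ideal.IsMaximal.isArtinianRing_quotient_pow {k : Type*} [CommRing k] [IsNoetherianRing k]
    {m : Ideal k} (hm : m.IsMaximal) (n : ℕ) : IsArtinianRing (k ⧸ m ^ n) := by
  rw [isArtinianRing_iff_krullDimLE_zero]
  refine Ring.KrullDimLE.mk₀ fun I hI ↦ ?_
  have hcomap : m = I.comap (Ideal.Quotient.mk (m ^ n)) := by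
    refine hm.eq_of_le (Ideal.IsPrime.ne_top inferInstance)
      (Ideal.IsPrime.le_of_pow_le (n := n) fun x hx ↦ ?_)
    rw [Ideal.mem_comap, Ideal.Quotient.eq_zero_iff_mem.mpr hx]
    exact I.zero_mem
  rw [← Ideal.map_comap_of_surjective _ Ideal.Quotient.mk_surjective I, ← hcomap]
  refine (Ideal.map_eq_top_or_isMaximal_of_surjective _ Ideal.Quotient.mk_surjective
    hm).resolve_left fun htop ↦ hI.ne_top ?_
  rw [← Ideal.map_comap_of_surjective _ Ideal.Quotient.mk_surjective I, ← hcomap, htop]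

/-- A finite module over a Noetherian ring killed by a power of a maximal ideal is Artinian. -/
theorem Ideal.IsMaximal.isArtinian_of_pow_smul_eq_zero {k M : Type*} [CommRing k]
    [IsNoetherianRing k] [AddCommGroup M] [Module k M] [Module.Finite k M] {m : Ideal k}
    (hm : m.IsMaximal) (n : ℕ) (h : Module.IsTorsionBySet k M ((m ^ n : Ideal k) : Set k)) :
    IsArtinian k M := by
  have := hm.isArtinianRing_quotient_pow n
  let := h.module
  have := h.isScalarTower (S := k)
  have : Module.Finite (k ⧸ m ^ n) M := Module.Finite.of_restrictScalars_finite k _ M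
  exact isArtinian_of_surjective_algebraMap (R := k ⧸ m ^ n) (S := k) Ideal.Quotient.mk_surjective

section SpectrumPreservingLemmas

variable {k L J : Type} [CommRing k] [Ring L] [Ring J] [Algebra k L] [Algebra k J]

/-- For finite algebras over a Noetherian ring, every primitive ideal of `L` containing the
preimage of a two-sided ideal of `J` contains the preimage of a primitive ideal containing it. -/
theorem exists_isPrimitiveIdeal_comap_le [IsNoetherianRing k] [Module.Finite k L]
    [Module.Finite k J] (φ : L →ₙₐ[k] J) (J' : Ideal J) (hJ' : ∀ x ∈ J', ∀ a : J, x * a ∈ J')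
    {Q : Ideal L} (hQ : IsPrimitiveIdeal L Q) (hJ'Q : ∀ x, φ x ∈ J' → x ∈ Q) :
    ∃ P : Ideal J, IsPrimitiveIdeal J P ∧ J' ≤ P ∧ ∀ x, φ x ∈ P → x ∈ Q := by
  obtain ⟨V, _, _, _, rfl⟩ := hQ
  let m := (Module.annihilator L V).comap (algebraMap k L)
  have hm : m.IsMaximal := isMaximal_comap_annihilator V
  have : Module.Finite k (J ⧸ J') :=
    Module.Finite.of_surjective (J'.mkQ.restrictScalars k) J'.mkQ_surjective
  let ψ : L →ₗ[k] J ⧸ J' := J'.mkQ.restrictScalars k ∘ₗ (φ : L →ₗ[k] J)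
  obtain ⟨c, hc⟩ := Ideal.exists_pow_inf_eq_pow_smul m (LinearMap.range ψ)
  let K : Submodule J (J ⧸ J') :=
    { (m ^ (c + 1) • ⊤ : Submodule k (J ⧸ J')) with
      smul_mem' := fun a x hx ↦ by
        have := Submodule.mem_map_of_mem (f := Algebra.lsmul k k (J ⧸ J') a) hx
        rw [Submodule.map_smul''] at this
        exact Submodule.smul_mono le_rfl le_top this }
  have hK (x : J ⧸ J') : x ∈ K ↔ x ∈ (m ^ (c + 1) • ⊤ : Submodule k (J ⧸ J')) := Iff.rfl
  have : Module.Finite k ((J ⧸ J') ⧸ K) :=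
    Module.Finite.of_surjective (K.mkQ.restrictScalars k) K.mkQ_surjective
  have : IsArtinian k ((J ⧸ J') ⧸ K) := by
    refine hm.isArtinian_of_pow_smul_eq_zero (c + 1) fun x r ↦ ?_
    obtain ⟨x, rfl⟩ := K.mkQ_surjective x
    refine (Submodule.Quotient.mk_eq_zero K).mpr ?_
    exact (hK _).mpr (Submodule.smul_mem_smul r.2 Submodule.mem_top)
  have hfin : IsFiniteLength J ((J ⧸ J') ⧸ K) :=
    isFiniteLength_iff_isNoetherian_isArtinian.mpr
      ⟨isNoetherian_of_tower k inferInstance, isArtinian_of_tower k inferInstance⟩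
  obtain ⟨P, hP, hle, hPV⟩ := hfin.exists_isPrimitiveIdeal_s12 φ (V := V) fun x hx ↦ by
    have hxK : ψ x ∈ K := by
      have := Module.mem_annihilator.mp hx (K.mkQ (J'.mkQ 1))
      rw [← map_smul, ← map_smul, smul_eq_mul, mul_one] at this
      exact (Submodule.Quotient.mk_eq_zero K).mp this
    have hxm : ψ x ∈ m • LinearMap.range ψ := by
      have : ψ x ∈ m ^ (c + 1 - c) • (m ^ c • ⊤ ⊓ LinearMap.range ψ) :=
        hc (c + 1) (Nat.le_succ c) ▸ ⟨hxK, LinearMap.mem_range_self ψ x⟩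
      rw [Nat.add_sub_cancel_left, pow_one] at this
      exact Submodule.smul_mono le_rfl inf_le_right this
    rw [LinearMap.range_eq_map, ← Submodule.map_smul''] at hxm
    obtain ⟨y, hy, hyx⟩ := hxm
    have hyV : y ∈ Module.annihilator L V := by
      refine Submodule.smul_induction_on hy (fun r hr l _ ↦ ?_) fun _ _ ↦ add_mem
      rw [Algebra.smul_def, Algebra.commutes]
      exact Ideal.mul_mem_left _ _ hr
    have hxy : φ (x - y) ∈ J' := by
      rw [← Submodule.Quotient.mk_eq_zero J']
      change ψ (x - y) = 0
      rw [map_sub, hyx, sub_self]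
    simpa using add_mem (hJ'Q _ hxy) hyV
  refine ⟨P, hP, fun x hx ↦ hle (Module.mem_annihilator.mpr fun z ↦ ?_), hPV⟩
  obtain ⟨z, rfl⟩ := K.mkQ_surjective z
  obtain ⟨z, rfl⟩ := J'.mkQ_surjective z
  rw [← map_smul, ← map_smul, smul_eq_mul, Submodule.mkQ_apply J',
    (Submodule.Quotient.mk_eq_zero J').mpr (hJ' x hx z), map_zero]

end SpectrumPreservingLemmas

/-- Corollary (cor.V): if `φ : L → J` is spectrum preserving with induced bijection
`φ* = f`, then `φ*(V(J')) = V(φ⁻¹(J'))` for every two-sided ideal `J'` of `J`. -/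
theorem image_of_vanishing_locus
    (k : Type) [CommRing k] [Algebra ℂ k] [Algebra.FiniteType ℂ k]
    (L J : Type) [Ring L] [Ring J] [Algebra k L] [Algebra k J]
    [Module.Finite k L] [Module.Finite k J]
    (φ : L →ₙₐ[k] J) (f : PrimSpec J → PrimSpec L) (hf : IsGraphOf φ f)
    (J' : Ideal J) (hJ' : ∀ x ∈ J', ∀ a : J, x * a ∈ J') :
    f '' {P : PrimSpec J | (J' : Set J) ⊆ (P.1 : Set J)} =
      {Q : PrimSpec L | (⇑φ) ⁻¹' (J' : Set J) ⊆ (Q.1 : Set L)} := by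
  have : IsNoetherianRing k := Algebra.FiniteType.isNoetherianRing ℂ k
  ext Q
  constructor
  · rintro ⟨P, hP, rfl⟩
    exact fun x hx ↦ (hf.2 P (f P)).mpr rfl (hP hx)
  · intro hQ
    obtain ⟨P, hP, hle, hPQ⟩ :=
      exists_isPrimitiveIdeal_comap_le φ J' hJ' Q.2 fun x hx ↦ hQ hx
    exact ⟨⟨P, hP⟩, hle, (hf.2 ⟨P, hP⟩ Q).mp hPQ⟩
end

section
/- Let k be a finitely generated commutative ℂ-algebra, L and J unital finite type k-algebras, and φ: L → J a spectrum preserving k-linear algebra homomorphism. Assume that every simple left J-module has complex dimension at most n. Then for every two-sided ideal L' of L, one has (φ*)⁻¹(V(L')) = V(Jφ(L')ⁿJ), where Jφ(L')ⁿJ denotes the two-sided ideal of J generated by all products φ(a₁)φ(a₂)⋯φ(aₙ) with a₁,…,aₙ ∈ L'. -/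
/-- The two-sided ideal `J φ(T)ⁿ J` of `J` generated by all products
`φ(a₁) ⋯ φ(aₙ)` with `a₁, …, aₙ ∈ T` (realized as the left ideal generated by the
right multiples of such products). -/
def prodIdeal {k L J : Type} [CommRing k] [Ring L] [Ring J] [Algebra k L] [Algebra k J]
    (φ : L →ₙₐ[k] J) (n : ℕ) (T : Set L) : Ideal J :=
  Ideal.span {y : J | ∃ a : Fin n → L, (∀ i, a i ∈ T) ∧
    ∃ c : J, y = (List.ofFn fun i => φ (a i)).prod * c}

/-- If `I` lies in every primitive ideal containing the annihilator of `M`, then `I` carries each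
nonzero finitely generated submodule of `M` into a proper submodule of it. -/
theorem exists_lt_forall_smul_mem {L M : Type} [Ring L] [AddCommGroup M] [Module L M]
    {I : Ideal L}
    (hI : ∀ Q : Ideal L, IsPrimitiveIdeal L Q → Module.annihilator L M ≤ Q → I ≤ Q)
    (N : Submodule L M) [Module.Finite L N] (hN : N ≠ ⊥) :
    ∃ N' < N, ∀ a ∈ I, ∀ x ∈ N, a • x ∈ N' := by
  have : Nontrivial N := Submodule.nontrivial_iff_ne_bot.2 hN
  obtain ⟨U, hU, -⟩ := (eq_top_or_exists_le_coatom (⊥ : Submodule L N)).resolve_left bot_ne_top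
  have hsimple : IsSimpleModule L (N ⧸ U) := isSimpleModule_iff_isCoatom.2 hU
  have hIU : I ≤ Module.annihilator L (N ⧸ U) := by
    refine hI _ ⟨N ⧸ U, inferInstance, inferInstance, hsimple, rfl⟩ fun x hx => ?_
    refine Module.mem_annihilator.2 fun q => ?_
    obtain ⟨y, rfl⟩ := U.mkQ_surjective q
    have : x • y = 0 := Subtype.ext (Module.mem_annihilator.1 hx (y : M))
    rw [← map_smul, this, map_zero]
  refine ⟨U.map N.subtype, lt_of_le_of_ne (Submodule.map_subtype_le N U) fun h => hU.1 ?_, ?_⟩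
  · refine Submodule.map_injective_of_injective N.injective_subtype ?_
    rw [h, Submodule.map_subtype_top]
  · intro a ha x hx
    refine ⟨a • ⟨x, hx⟩, ?_, rfl⟩
    rw [SetLike.mem_coe, ← Submodule.Quotient.mk_eq_zero, Submodule.Quotient.mk_smul]
    exact Module.mem_annihilator.1 (hIU ha) _

/-- If `I` lies in every primitive ideal containing the annihilator of `M`, then products of at
least `dim N` elements of `I` kill the submodule `N` of the finite-dimensional module `M`. -/
theorem prod_smul_eq_zero_of_finrank_le {K L M : Type} [Field K] [Ring L] [Algebra K L]
    [AddCommGroup M] [Module K M] [Module L M] [IsScalarTower K L M] [FiniteDimensional K M]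
    {I : Ideal L}
    (hI : ∀ Q : Ideal L, IsPrimitiveIdeal L Q → Module.annihilator L M ≤ Q → I ≤ Q)
    (l : List L) (hl : ∀ a ∈ l, a ∈ I) (N : Submodule L M)
    (hN : Module.finrank K (N.restrictScalars K) ≤ l.length) {x : M} (hx : x ∈ N) :
    l.prod • x = 0 := by
  induction l using List.reverseRecOn generalizing N x with
  | nil =>
    have h0 : N.restrictScalars K = ⊥ := Submodule.finrank_eq_zero.1 (Nat.le_zero.1 hN)
    have hx' : x ∈ N.restrictScalars K := hx
    rw [h0, Submodule.mem_bot] at hx'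
    rw [hx', smul_zero]
  | append_singleton l a ih =>
    by_cases hbot : N = ⊥
    · rw [hbot, Submodule.mem_bot] at hx
      rw [hx, smul_zero]
    have : Module.Finite K N := inferInstanceAs (Module.Finite K (N.restrictScalars K))
    have : Module.Finite L N := Module.Finite.of_restrictScalars_finite K L N
    obtain ⟨N', hlt, hmem⟩ := exists_lt_forall_smul_mem hI N hbot
    have hfin : Module.finrank K (N'.restrictScalars K) <
        Module.finrank K (N.restrictScalars K) := Submodule.finrank_lt_finrank_of_lt hlt
    rw [List.length_append, List.length_singleton] at hN
    rw [List.prod_append, List.prod_singleton, mul_smul]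
    exact ih (fun b hb => hl b (by simp [hb])) N' (by omega) (hmem a (hl a (by simp)) x hx)

/-- A right ideal not annihilating a simple module has nonvanishing products of any length on
every nonzero vector. -/
theorem exists_prod_smul_ne_zero {L S : Type} [Ring L] [AddCommGroup S] [Module L S]
    [IsSimpleModule L S] {I : Ideal L} (hI : ∀ x ∈ I, ∀ a : L, x * a ∈ I)
    (hS : ¬ I ≤ Module.annihilator L S) (n : ℕ) {x : S} (hx : x ≠ 0) :
    ∃ a : Fin n → L, (∀ i, a i ∈ I) ∧ (List.ofFn a).prod • x ≠ 0 := by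
  let U : Submodule L S :=
    { carrier := {y | ∀ a ∈ I, a • y = 0}
      add_mem' := fun hy hz a ha => by rw [smul_add, hy a ha, hz a ha, add_zero]
      zero_mem' := fun a _ => smul_zero a
      smul_mem' := fun b y hy a ha => by rw [← mul_smul]; exact hy _ (hI a ha b) }
  have hU : U = ⊥ := (eq_bot_or_eq_top U).resolve_right fun h => hS fun a ha =>
    Module.mem_annihilator.2 fun y => (h ▸ Submodule.mem_top : y ∈ U) a ha
  induction n with
  | zero => exact ⟨Fin.elim0, fun i => i.elim0, by simpa using hx⟩
  | succ n ih =>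
    obtain ⟨a, ha, hax⟩ := ih
    have hU' : (List.ofFn a).prod • x ∉ U := by rwa [hU, Submodule.mem_bot]
    obtain ⟨b, hb, hbx⟩ : ∃ b ∈ I, b • (List.ofFn a).prod • x ≠ 0 := by
      by_contra! h
      exact hU' h
    refine ⟨Fin.cons b a, Fin.cases hb ha, ?_⟩
    simpa [List.ofFn_succ, mul_smul] using hbx

section UnitalPart
variable {k L J : Type} [CommRing k] [Ring L] [Ring J] [Algebra k L] [Algebra k J]

/-- The subgroup `φ(1)V` of a `J`-module `V`, on which `L` acts unitally through `φ`. -/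
def unitalPart (φ : L →ₙₐ[k] J) (V : Type) [AddCommGroup V] [Module J V] : AddSubgroup V where
  carrier := {v | φ 1 • v = v}
  add_mem' {v w} hv hw := by
    rw [Set.mem_ofPred_eq] at *
    rw [smul_add, hv, hw]
  zero_mem' := smul_zero _
  neg_mem' {v} hv := by
    rw [Set.mem_ofPred_eq] at *
    rw [smul_neg, hv]

variable (φ : L →ₙₐ[k] J) (V : Type) [AddCommGroup V] [Module J V]

theorem map_smul_mem_unitalPart (a : L) (v : V) : φ a • v ∈ unitalPart φ V := by
  change φ 1 • φ a • v = φ a • v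
  rw [← mul_smul, ← map_mul, one_mul]

instance : Module L (unitalPart φ V) where
  smul a v := ⟨φ a • (v : V), map_smul_mem_unitalPart φ V a v⟩
  one_smul v := Subtype.ext v.2
  mul_smul a b v := Subtype.ext <| by
    change φ (a * b) • (v : V) = φ a • φ b • (v : V)
    rw [map_mul, mul_smul]
  smul_zero a := Subtype.ext (smul_zero (φ a))
  smul_add a v w := Subtype.ext (smul_add (φ a) (v : V) w)
  add_smul a b v := Subtype.ext <| by
    change φ (a + b) • (v : V) = φ a • (v : V) + φ b • (v : V)
    rw [map_add, add_smul]
  zero_smul v := Subtype.ext <| by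
    change φ 0 • (v : V) = 0
    rw [map_zero, zero_smul]

theorem coe_smul_unitalPart (a : L) (v : unitalPart φ V) :
    ((a • v : unitalPart φ V) : V) = φ a • (v : V) := rfl

end UnitalPart

theorem map_prod_ofFn_succ {k L J : Type} [CommRing k] [Ring L] [Ring J] [Algebra k L]
    [Algebra k J] (φ : L →ₙₐ[k] J) (n : ℕ) (a : Fin (n + 1) → L) :
    (List.ofFn fun i => φ (a i)).prod = φ (List.ofFn a).prod := by
  induction n with
  | zero => simp
  | succ n ih =>
    rw [List.ofFn_succ, List.prod_cons, ih fun i => a i.succ, List.ofFn_succ (f := a),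
      List.prod_cons, map_mul]

/-- If `I` lies in every primitive ideal containing the annihilator of `φ(1)V`, then products of
`n ≥ dim V` elements of `φ(I)` kill `V`. -/
theorem prod_map_smul_eq_zero {k L J : Type} [CommRing k] [Algebra ℂ k] [Ring L] [Ring J]
    [Algebra k L] [Algebra k J] [Algebra ℂ J] [IsScalarTower ℂ k J] (φ : L →ₙₐ[k] J)
    {V : Type} [AddCommGroup V] [Module J V] [Module ℂ V] [IsScalarTower ℂ J V] {n : ℕ}
    (hn : Module.rank ℂ V ≤ (n : Cardinal)) {I : Ideal L}
    (hI : ∀ Q : Ideal L, IsPrimitiveIdeal L Q →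
      Module.annihilator L (unitalPart φ V) ≤ Q → I ≤ Q)
    (a : Fin n → L) (ha : ∀ i, a i ∈ I) (v : V) :
    (List.ofFn fun i => φ (a i)).prod • v = 0 := by
  obtain _ | n := n
  · have : Subsingleton V := rank_zero_iff.1 (by simpa using hn)
    exact Subsingleton.elim _ _
  let _ : Algebra ℂ L := Algebra.compHom L (algebraMap ℂ k)
  let _ : Module ℂ (unitalPart φ V) := Module.compHom _ (algebraMap ℂ L)
  have : IsScalarTower ℂ L (unitalPart φ V) := IsScalarTower.of_algebraMap_smul fun _ _ => rfl
  let ι : unitalPart φ V →ₗ[ℂ] V :=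
    { toFun := Subtype.val
      map_add' := fun _ _ => rfl
      map_smul' := fun c w => by
        change φ (algebraMap k L (algebraMap ℂ k c)) • (w : V) = c • (w : V)
        rw [Algebra.algebraMap_eq_smul_one, map_smul, algebraMap_smul, smul_assoc]
        exact congrArg (c • ·) w.2 }
  have hle : Module.rank ℂ (unitalPart φ V) ≤ ((n + 1 : ℕ) : Cardinal) :=
    (LinearMap.rank_le_of_injective ι Subtype.val_injective).trans hn
  have : FiniteDimensional ℂ (unitalPart φ V) :=
    Module.rank_lt_aleph0_iff.1 (hle.trans_lt (Cardinal.natCast_lt_aleph0))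
  have hfin : Module.finrank ℂ (unitalPart φ V) ≤ n + 1 :=
    Module.finrank_le_of_rank_le hle
  have hzero := prod_smul_eq_zero_of_finrank_le (K := ℂ) hI (List.ofFn a)
    (List.forall_mem_ofFn_iff.2 ha) ⊤
    (by rw [List.length_ofFn]; exact (Submodule.finrank_le _).trans hfin)
    (x := ⟨φ 1 • v, map_smul_mem_unitalPart φ V 1 v⟩) Submodule.mem_top
  have := congrArg Subtype.val hzero
  rwa [coe_smul_unitalPart, ← mul_smul, ← map_mul, mul_one, ← map_prod_ofFn_succ] at this


/-- If `φ : L → J` is spectrum preserving with induced bijection `φ* = f` and all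
simple left `J`-modules have complex dimension `≤ n`, then
`(φ*)⁻¹(V(L')) = V(J φ(L')ⁿ J)` for every two-sided ideal `L'` of `L`. -/
theorem preimage_of_vanishing_locus
    (k : Type) [CommRing k] [Algebra ℂ k] [Algebra.FiniteType ℂ k]
    (L J : Type) [Ring L] [Ring J] [Algebra k L] [Algebra k J]
    [Module.Finite k L] [Module.Finite k J]
    [Algebra ℂ J] [IsScalarTower ℂ k J]
    (φ : L →ₙₐ[k] J) (f : PrimSpec J → PrimSpec L) (hf : IsGraphOf φ f)
    (n : ℕ)
    (hdim : ∀ (V : Type) (_ : AddCommGroup V) (_ : Module J V),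
      IsSimpleModule J V →
        letI : Module ℂ V := Module.compHom V (algebraMap ℂ J)
        Module.rank ℂ V ≤ (n : Cardinal))
    (L' : Ideal L) (hL' : ∀ x ∈ L', ∀ a : L, x * a ∈ L') :
    f ⁻¹' {Q : PrimSpec L | (L' : Set L) ⊆ (Q.1 : Set L)} =
      {P : PrimSpec J | prodIdeal φ n L' ≤ P.1} := by
  ext P
  obtain ⟨V, _, _, hV, hPV⟩ := P.2
  constructor
  · intro hQ
    refine Ideal.span_le.2 ?_
    rintro _ ⟨a, ha, c, rfl⟩
    rw [hPV]
    refine Module.mem_annihilator.2 fun v => ?_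
    let _ : Module ℂ V := Module.compHom V (algebraMap ℂ J)
    have : IsScalarTower ℂ J V := IsScalarTower.of_algebraMap_smul fun _ _ => rfl
    rw [mul_smul]
    refine prod_map_smul_eq_zero φ (hdim V _ _ hV) (I := L') (fun Q hQprim hann => ?_) a ha _
    have hfP : f P = ⟨Q, hQprim⟩ := (hf.2 P ⟨Q, hQprim⟩).1 fun x hx => hann <| by
      refine Module.mem_annihilator.2 fun w => Subtype.ext ?_
      rw [Set.mem_preimage, SetLike.mem_coe, hPV] at hx
      exact Module.mem_annihilator.1 hx (w : V)
    rw [Set.mem_preimage, hfP] at hQ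
    exact hQ
  · intro hP
    obtain ⟨S, _, _, hS, hQS⟩ := (f P).2
    by_contra hnot
    have hnot' : ¬ L' ≤ Module.annihilator L S := fun h => hnot <| by
      rw [← hQS] at h
      exact h
    have := IsSimpleModule.nontrivial L S
    obtain ⟨x, hx⟩ := exists_ne (0 : S)
    obtain ⟨a, ha, hax⟩ := exists_prod_smul_ne_zero hL' hnot' n hx
    have hmem : (List.ofFn fun i => φ (a i)).prod ∈ P.1 :=
      hP (Ideal.subset_span ⟨a, ha, 1, (mul_one _).symm⟩)
    obtain _ | n := n
    · have := IsSimpleModule.nontrivial J V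
      obtain ⟨v, hv⟩ := exists_ne (0 : V)
      rw [hPV, Module.mem_annihilator] at hmem
      exact hv (by simpa using hmem v)
    · rw [map_prod_ofFn_succ] at hmem
      have hprod := (hf.2 P (f P)).2 rfl hmem
      rw [SetLike.mem_coe, hQS, Module.mem_annihilator] at hprod
      exact hax (hprod x)
end

section
/- Let k be a finitely generated commutative ℂ-algebra, L and J unital finite type k-algebras, and φ: L → J a spectrum preserving k-linear algebra homomorphism. Then the induced bijection φ*: Prim(J) → Prim(L) is a homeomorphism for the Jacobson topologies: for every subset C ⊆ Prim(J), C is of the form V(S) for some S ⊆ J if and only if φ*(C) is of the form V(S') for some S' ⊆ L. -/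
namespace IsPrimitiveIdeal

variable {A : Type} [Ring A] {P : Ideal A}

theorem mul_mem_right (hP : IsPrimitiveIdeal A P) {x : A} (hx : x ∈ P) (y : A) : x * y ∈ P := by
  obtain ⟨V, _, _, -, rfl⟩ := hP
  rw [Module.mem_annihilator] at hx ⊢
  intro v
  rw [mul_smul]
  exact hx _

/-- Primitive ideals are prime. -/
theorem exists_mul_mul_notMem_s14 (hP : IsPrimitiveIdeal A P) {x y : A} (hx : x ∉ P) (hy : y ∉ P) :
    ∃ a, x * (a * y) ∉ P := by
  obtain ⟨V, _, _, _, rfl⟩ := hP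
  simp only [Module.mem_annihilator, not_forall] at hx hy ⊢
  obtain ⟨v, hv⟩ := hx
  obtain ⟨w, hw⟩ := hy
  obtain ⟨a, ha⟩ := IsSimpleModule.toSpanSingleton_surjective A hw v
  refine ⟨a, w, ?_⟩
  rw [LinearMap.toSpanSingleton_apply] at ha
  rwa [mul_smul, mul_smul, ha]

theorem algebraMap_smul_mem {k : Type} [CommRing k] [Algebra k A] {a : k}
    (ha : algebraMap k A a ∈ P) (x : A) : a • x ∈ P := by
  rw [Algebra.smul_def, Algebra.commutes]
  exact P.mul_mem_left x ha

theorem isMaximal_comap_algebraMap_s14 {k : Type} [CommRing k] [Algebra k A] [Module.Finite k A]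
    (hP : IsPrimitiveIdeal A P) : (P.comap (algebraMap k A)).IsMaximal := by
  obtain ⟨V, _, _, _, rfl⟩ := hP
  let _ : Module k V := Module.compHom V (algebraMap k A)
  have hs (a : k) (v : V) : a • v = algebraMap k A a • v := rfl
  have : IsScalarTower k A V := ⟨fun a x v => by rw [hs, Algebra.smul_def, mul_smul]⟩
  have : Module.Finite k V := Module.Finite.trans A V
  have hmem (a : k) : a ∈ (Module.annihilator A V).comap (algebraMap k A) ↔ ∀ v : V, a • v = 0 := by
    rw [Ideal.mem_comap, Module.mem_annihilator]
    rfl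
  have := IsSimpleModule.nontrivial A V
  rw [Ideal.isMaximal_iff]
  refine ⟨fun h => ?_, fun I a hI ha haI => ?_⟩
  · obtain ⟨v, hv⟩ := exists_ne (0 : V)
    exact hv (by simpa using (hmem 1).1 h v)
  · rw [hmem, not_forall] at ha
    obtain ⟨v, hv⟩ := ha
    have htop : (⊤ : Submodule k V) ≤ I • ⊤ := by
      intro w _
      obtain ⟨b, hb⟩ := IsSimpleModule.toSpanSingleton_surjective A hv w
      rw [LinearMap.toSpanSingleton_apply, smul_comm] at hb
      rw [← hb]
      exact Submodule.smul_mem_smul haI trivial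
    obtain ⟨r, hr, h0⟩ := Submodule.exists_sub_one_mem_and_smul_eq_zero_of_fg_of_le_smul I
      (⊤ : Submodule k V) Module.Finite.fg_top htop
    have hrI : r ∈ I := hI ((hmem r).2 fun v => h0 v trivial)
    simpa using I.sub_mem hrI hr

/-- The annihilator of a simple subquotient is primitive. -/
theorem exists_of_covBy {X : Type} [AddCommGroup X] [Module A X] {M N : Submodule A X}
    (h : M ⋖ N) : ∃ P : Ideal A, IsPrimitiveIdeal A P ∧ ∀ x, x ∈ P ↔ ∀ n ∈ N, x • n ∈ M := by
  refine ⟨_, ⟨N ⧸ M.comap N.subtype, inferInstance, inferInstance,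
    (covBy_iff_quot_is_simple h.le).1 h, rfl⟩, fun x => ?_⟩
  rw [Module.mem_annihilator]
  refine ⟨fun hx n hn => ?_, fun hx q => ?_⟩
  · have := hx (Submodule.Quotient.mk ⟨n, hn⟩)
    rw [← Submodule.Quotient.mk_smul, Submodule.Quotient.mk_eq_zero] at this
    simpa using this
  · obtain ⟨⟨n, hn⟩, rfl⟩ := Submodule.Quotient.mk_surjective _ q
    rw [← Submodule.Quotient.mk_smul, Submodule.Quotient.mk_eq_zero]
    simpa using hx n hn

end IsPrimitiveIdeal

/-- A module spanned by `r` elements and killed by an ideal `m` is a quotient of `(k ⧸ m)ʳ`. -/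
theorem exists_surjective_pi_quotient {k X : Type} [CommRing k] [AddCommGroup X] [Module k X]
    {m : Ideal k} (hm : ∀ a ∈ m, ∀ x : X, a • x = 0) {r : ℕ} (g : Fin r → X)
    (hg : Submodule.span k (Set.range g) = ⊤) :
    ∃ F : (Fin r → k ⧸ m) →ₗ[k] X, Function.Surjective F := by
  have hle (i : Fin r) : m ≤ LinearMap.ker (LinearMap.toSpanSingleton k X (g i)) := fun a ha => by
    simpa using hm a ha (g i)
  refine ⟨LinearMap.lsum k (fun _ => k ⧸ m) k fun i => Submodule.liftQ m _ (hle i), ?_⟩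
  rw [← LinearMap.range_eq_top, eq_top_iff, ← hg, Submodule.span_le]
  rintro _ ⟨i, rfl⟩
  refine ⟨Pi.single i (Submodule.Quotient.mk 1), ?_⟩
  rw [LinearMap.lsum_piSingle, Submodule.liftQ_apply]
  simp

section FiniteTypeMorphism

variable {k L J : Type} [CommRing k] [Ring L] [Ring J] [Algebra k L] [Algebra k J]
variable (φ : L →ₙₐ[k] J)

/-- If every primitive ideal of `L` above `φ⁻¹(P)` contains `I`, then `I • N` is strictly smaller
than `N` modulo `φ⁻¹(P)`, unless `N ⊆ φ⁻¹(P)`. -/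
theorem exists_mem_forall_map_sub_notMem [IsNoetherianRing L] {P : Ideal J}
    (hP : IsPrimitiveIdeal J P) {I : Ideal L}
    (hI : ∀ Q, IsPrimitiveIdeal L Q → (∀ x, φ x ∈ P → x ∈ Q) → I ≤ Q)
    {N : Ideal L} (hN : ∃ n ∈ N, φ n ∉ P) :
    ∃ n ∈ N, ∀ n' ∈ I • N, φ (n - n') ∉ P := by
  let K : Ideal L :=
    { carrier := {x | φ x ∈ P}
      add_mem' := fun {x y} hx hy => by
        simpa using P.add_mem hx hy
      zero_mem' := by simp
      smul_mem' := fun c x hx => by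
        simpa using P.mul_mem_left _ hx }
  have hK (x : L) : x ∈ K ↔ φ x ∈ P := Iff.rfl
  have hlt : N ⊓ K < N := by
    obtain ⟨n, hn, hn'⟩ := hN
    exact lt_of_le_of_ne inf_le_left fun h => hn' (inf_eq_left.1 h hn)
  obtain ⟨M, hKM, hMN⟩ := IsStronglyCoatomic.exists_le_covBy_of_lt _ _ hlt
  obtain ⟨Q, hQ, hQM⟩ := IsPrimitiveIdeal.exists_of_covBy hMN
  have hIQ : I ≤ Q := hI Q hQ fun x hx => (hQM x).2 fun n hn => hKM
    ⟨N.smul_mem x hn, by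
      change φ (x * n) ∈ P
      rw [map_mul]
      exact hP.mul_mem_right hx _⟩
  have hIN : I • N ≤ M := Submodule.smul_le.2 fun x hx n hn => (hQM x).1 (hIQ hx) n hn
  obtain ⟨n, hn, hnM⟩ := SetLike.exists_of_lt hMN.lt
  refine ⟨n, hn, fun n' hn' hmem => hnM ?_⟩
  have hsub : n - n' ∈ M := hKM ⟨N.sub_mem hn (hMN.le (hIN hn')), hmem⟩
  simpa using M.add_mem hsub (hIN hn')

/-- If every primitive ideal of `L` above `φ⁻¹(P)` contains `I`, then `φ⁻¹(P)` contains a power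
of `I` whose exponent is bounded by the number of generators of `J`. -/
theorem map_mem_of_mem_iterate_smul [IsNoetherianRing k] [Module.Finite k L]
    {r : ℕ} (g : Fin r → J) (hg : Submodule.span k (Set.range g) = ⊤) {P : Ideal J}
    (hP : IsPrimitiveIdeal J P) {I : Ideal L}
    (hI : ∀ Q, IsPrimitiveIdeal L Q → (∀ x, φ x ∈ P → x ∈ Q) → I ≤ Q)
    {x : L} (hx : x ∈ (fun N : Ideal L => I • N)^[r] ⊤) : φ x ∈ P := by
  have : IsNoetherian k L := isNoetherian_of_isNoetherianRing_of_finite k L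
  have : IsNoetherianRing L := isNoetherian_of_tower k ‹_›
  have : Module.Finite k J := ⟨Submodule.fg_def.2 ⟨_, Set.finite_range g, hg⟩⟩
  have hmax := hP.isMaximal_comap_algebraMap_s14 (k := k)
  set m := P.comap (algebraMap k J)
  let q : J →ₗ[k] J ⧸ P.restrictScalars k := (P.restrictScalars k).mkQ
  obtain ⟨F, hF⟩ := exists_surjective_pi_quotient (m := m) (X := J ⧸ P.restrictScalars k)
    (fun a ha y => by
      obtain ⟨y, rfl⟩ := Submodule.Quotient.mk_surjective _ y
      rw [← Submodule.Quotient.mk_smul, Submodule.Quotient.mk_eq_zero]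
      exact IsPrimitiveIdeal.algebraMap_smul_mem ha y)
    (q ∘ g) (by rw [Set.range_comp, Submodule.span_image, hg, Submodule.map_top,
      Submodule.range_mkQ])
  have : IsSimpleModule k (k ⧸ m) := isSimpleModule_iff_isCoatom.2 hmax.out
  have : IsArtinian k (J ⧸ P.restrictScalars k) := isArtinian_of_surjective _ F hF
  have hlen : Module.length k (J ⧸ P.restrictScalars k) ≤ r := by
    simpa [Module.length_pi, Module.length_eq_one] using Module.length_le_of_surjective F hF
  let ψ : L →ₗ[k] J ⧸ P.restrictScalars k := q ∘ₗ (φ : L →ₗ[k] J)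
  have hψ (y : L) : ψ y = 0 ↔ φ y ∈ P := Submodule.Quotient.mk_eq_zero _
  have key (i : ℕ) : (∀ n ∈ (fun N : Ideal L => I • N)^[i] ⊤, φ n ∈ P) ∨
      Module.length k
        ((((fun N : Ideal L => I • N)^[i] ⊤).restrictScalars k).map ψ) + i ≤ r := by
    induction i with
    | zero =>
      right
      rw [Nat.cast_zero, add_zero]
      exact (Module.length_le_of_injective _ (Submodule.subtype_injective _)).trans hlen
    | succ i ih =>
      rw [Function.iterate_succ_apply']
      set N := (fun N : Ideal L => I • N)^[i] ⊤
      have hle : I • N ≤ N := Submodule.smul_le.2 fun _ _ n hn => N.smul_mem _ hn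
      rcases ih with h | h
      · exact Or.inl fun n hn => h n (hle hn)
      by_cases hN : ∃ n ∈ N, φ n ∉ P
      · right
        obtain ⟨n, hn, hn'⟩ := exists_mem_forall_map_sub_notMem φ hP hI hN
        have hlt : ((I • N).restrictScalars k).map ψ < (N.restrictScalars k).map ψ := by
          refine lt_of_le_of_ne (Submodule.map_mono hle) fun he => ?_
          obtain ⟨n', h1, h2⟩ := he.ge
            (Submodule.mem_map_of_mem (f := ψ) (p := N.restrictScalars k) hn)
          exact hn' n' h1 ((hψ _).1 (by rw [map_sub, h2, sub_self]))
        have := Submodule.height_strictMono hlt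
        rw [← Module.length_submodule, ← Module.length_submodule] at this
        refine le_trans ?_ h
        rw [Nat.cast_succ, add_comm (i : ℕ∞) 1, ← add_assoc]
        gcongr
        exact Order.add_one_le_of_lt this
      · push Not at hN
        exact Or.inl fun n hn => hN n (hle hn)
  rcases key r with h | h
  · exact h x hx
  · have h0 : Module.length k
        ((((fun N : Ideal L => I • N)^[r] ⊤).restrictScalars k).map ψ) = 0 := by
      have := (ENat.addLECancellable_of_ne_top (ENat.natCast_ne_top r)).add_le_add_iff_right.1
        (h.trans (zero_add (r : ℕ∞)).ge)
      simpa using this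
    rw [Module.length_eq_zero_iff, Submodule.subsingleton_iff_eq_bot] at h0
    rw [← hψ, ← Submodule.mem_bot k, ← h0]
    exact Submodule.mem_map_of_mem hx

theorem IsPrimitiveIdeal.le_of_iterate_smul_le {Q : Ideal L} (hQ : IsPrimitiveIdeal L Q)
    {I : Ideal L} (n : ℕ) (h : (fun N : Ideal L => I • N)^[n] ⊤ ≤ Q) : I ≤ Q := by
  intro x hx
  by_contra hxQ
  have key (i : ℕ) : ∃ y ∈ (fun N : Ideal L => I • N)^[i] ⊤, y ∉ Q := by
    induction i with
    | zero => exact ⟨x, trivial, hxQ⟩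
    | succ i ih =>
      obtain ⟨y, hy, hyQ⟩ := ih
      obtain ⟨a, ha⟩ := hQ.exists_mul_mul_notMem_s14 hxQ hyQ
      refine ⟨_, ?_, ha⟩
      rw [Function.iterate_succ_apply']
      exact Submodule.smul_mem_smul hx (Ideal.mul_mem_left _ a hy)
  obtain ⟨y, hy, hyQ⟩ := key n
  exact hyQ (h hy)

/-- If no primitive ideal of `J` above `I` lies over `Q`, then some `x ∉ Q` generates a left ideal
which `φ` maps into the left ideal `N`, provided `J ⧸ N` is artinian. -/
theorem exists_notMem_forall_map_mul_mem {Q : Ideal L} (hQ : IsPrimitiveIdeal L Q)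
    {I N : Ideal J} [IsArtinian J (J ⧸ N)] [IsNoetherian J (J ⧸ N)]
    (hIN : ∀ i ∈ I, ∀ j : J, i * j ∈ N)
    (h : ∀ P, IsPrimitiveIdeal J P → I ≤ P → ∃ y, φ y ∈ P ∧ y ∉ Q) :
    ∃ x, x ∉ Q ∧ ∀ l, φ (l * x) ∈ N := by
  have h1 : (1 : L) ∉ Q := fun h1 => by
    obtain ⟨V, _, _, _, rfl⟩ := hQ
    have := IsSimpleModule.nontrivial L V
    obtain ⟨v, hv⟩ := exists_ne (0 : V)
    exact hv (by simpa using Module.mem_annihilator.1 h1 v)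
  obtain ⟨W, ⟨x, hx, hxW⟩, hmin⟩ := IsArtinian.set_has_minimal
    {W : Submodule J (J ⧸ N) | ∃ x, x ∉ Q ∧ ∀ l, ∀ w : J ⧸ N, φ (l * x) • w ∈ W}
    ⟨⊤, 1, h1, fun _ _ => trivial⟩
  rcases eq_or_ne W ⊥ with rfl | hW
  · refine ⟨x, hx, fun l => ?_⟩
    have := hxW l (Submodule.Quotient.mk 1)
    rw [← Submodule.Quotient.mk_smul, Submodule.mem_bot, Submodule.Quotient.mk_eq_zero] at this
    simpa using this
  exfalso
  obtain ⟨M, -, hM⟩ := IsStronglyCoatomic.exists_le_covBy_of_lt _ _ (bot_lt_iff_ne_bot.2 hW)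
  obtain ⟨P, hP, hPM⟩ := IsPrimitiveIdeal.exists_of_covBy hM
  obtain ⟨y, hyP, hyQ⟩ := h P hP fun i hi => (hPM i).2 fun w _ => by
    obtain ⟨j, rfl⟩ := Submodule.Quotient.mk_surjective _ w
    rw [← Submodule.Quotient.mk_smul, smul_eq_mul,
      (Submodule.Quotient.mk_eq_zero _).2 (hIN i hi j)]
    exact M.zero_mem
  obtain ⟨a, ha⟩ := hQ.exists_mul_mul_notMem_s14 hyQ hx
  refine hmin M ⟨_, ha, fun l w => ?_⟩ hM.lt
  rw [← mul_assoc, map_mul, mul_smul]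
  refine (hPM _).1 ?_ _ (hxW a w)
  rw [map_mul]
  exact P.mul_mem_left _ hyP

/-- Lying over: a primitive ideal `Q` of `L` above the preimage of a two-sided ideal `I` of `J`
lies over some primitive ideal of `J` above `I`. -/
theorem exists_isPrimitiveIdeal_preimage_le [IsNoetherianRing k] [Module.Finite k L]
    [Module.Finite k J] {I : Ideal J} (hI : ∀ i ∈ I, ∀ j : J, i * j ∈ I)
    {Q : Ideal L} (hQ : IsPrimitiveIdeal L Q) (hIQ : ∀ x, φ x ∈ I → x ∈ Q) :
    ∃ P, IsPrimitiveIdeal J P ∧ I ≤ P ∧ ∀ x, φ x ∈ P → x ∈ Q := by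
  by_contra! hcon
  have hmax := hQ.isMaximal_comap_algebraMap_s14 (k := k)
  set m := Q.comap (algebraMap k L)
  let E (n : ℕ) : Submodule k J := I.restrictScalars k ⊔ m ^ n • ⊤
  have hsmul (n : ℕ) (j : J) {d : J} (hd : d ∈ m ^ n • (⊤ : Submodule k J)) :
      j * d ∈ m ^ n • (⊤ : Submodule k J) := by
    induction hd using Submodule.smul_induction_on' with
    | smul a ha y _ =>
      rw [mul_smul_comm]
      exact Submodule.smul_mem_smul ha trivial
    | add d _ e _ hd he =>
      rw [mul_add]
      exact Submodule.add_mem _ hd he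
  let N : Ideal J :=
    { E 1 with
      smul_mem' := fun j y hy => by
        change j * y ∈ E 1
        obtain ⟨i, hi, d, hd, rfl⟩ := Submodule.mem_sup.1 hy
        rw [mul_add]
        exact Submodule.add_mem_sup (I.mul_mem_left j hi) (hsmul 1 j hd) }
  have hIE (n : ℕ) {i : J} (hi : i ∈ I) : i ∈ E n := Submodule.mem_sup_left hi
  have : IsSimpleModule k (k ⧸ m) := isSimpleModule_iff_isCoatom.2 hmax.out
  obtain ⟨r, g, hg⟩ := Module.Finite.exists_fin (R := k) (M := J ⧸ N)
  obtain ⟨F, hF⟩ := exists_surjective_pi_quotient (m := m) (X := J ⧸ N)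
    (fun a ha y => by
      obtain ⟨y, rfl⟩ := Submodule.Quotient.mk_surjective _ y
      rw [← Submodule.Quotient.mk_smul, Submodule.Quotient.mk_eq_zero]
      refine Submodule.mem_sup_right (S := I.restrictScalars k) ?_
      rw [pow_one]
      exact Submodule.smul_mem_smul ha trivial) g hg
  have : IsArtinian J (J ⧸ N) := isArtinian_of_tower k (isArtinian_of_surjective _ F hF)
  have : IsNoetherian J (J ⧸ N) := isNoetherian_of_tower k (isNoetherian_of_surjective F
    (LinearMap.range_eq_top.2 hF))
  obtain ⟨x, hxQ, hx⟩ := exists_notMem_forall_map_mul_mem φ hQ (I := I) (N := N)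
    (fun i hi j => hIE 1 (hI i hi j)) hcon
  have key (n : ℕ) : ∃ y, y ∉ Q ∧ ∀ l, φ (l * y) ∈ E n := by
    induction n with
    | zero => exact ⟨x, hxQ, fun l => by simp [E]⟩
    | succ n ih =>
      obtain ⟨y, hyQ, hy⟩ := ih
      obtain ⟨a, ha⟩ := hQ.exists_mul_mul_notMem_s14 hyQ hxQ
      refine ⟨_, ha, fun l => ?_⟩
      rw [← mul_assoc, map_mul]
      obtain ⟨i, hi, d, hd, hid⟩ := Submodule.mem_sup.1 (hy l)
      obtain ⟨i', hi', d', hd', hid'⟩ := Submodule.mem_sup.1 (show φ (a * x) ∈ E 1 from hx a)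
      rw [← hid, ← hid', add_mul, mul_add d]
      refine add_mem (hIE _ (hI i hi _)) (add_mem (hIE _ (I.mul_mem_left d hi')) ?_)
      refine Submodule.mem_sup_right ?_
      clear hid
      induction hd using Submodule.smul_induction_on' with
      | smul b hb z _ =>
        rw [smul_mul_assoc, pow_succ, mul_smul]
        exact Submodule.smul_mem_smul hb (by simpa using hsmul 1 z hd')
      | add d _ e _ hd he =>
        rw [add_mul]
        exact Submodule.add_mem _ hd he
  let q : J →ₗ[k] J ⧸ I.restrictScalars k := (I.restrictScalars k).mkQ
  let ψ : L →ₗ[k] J ⧸ I.restrictScalars k := q ∘ₗ (φ : L →ₗ[k] J)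
  obtain ⟨c, hc⟩ := Ideal.exists_pow_inf_eq_pow_smul m ((⊤ : Submodule k L).map ψ)
  obtain ⟨y, hyQ, hy⟩ := key (c + 1)
  have hy1 : ψ y ∈ m ^ (c + 1) • (⊤ : Submodule k (J ⧸ I.restrictScalars k)) := by
    obtain ⟨i, hi, d, hd, hid⟩ := Submodule.mem_sup.1 (hy 1)
    have hψ : ψ y = q d := by
      rw [one_mul] at hid
      have : q i = 0 := (Submodule.Quotient.mk_eq_zero _).2 hi
      change q (φ y) = q d
      rw [← hid, map_add, this, zero_add]
    rw [hψ]
    have := Submodule.mem_map_of_mem (f := q) hd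
    rw [Submodule.map_smul''] at this
    exact Submodule.smul_mono le_rfl le_top this
  have hy2 : ψ y ∈ (m • (⊤ : Submodule k L)).map ψ := by
    have : ψ y ∈ m ^ (c + 1) • ⊤ ⊓ (⊤ : Submodule k L).map ψ := ⟨hy1, y, trivial, rfl⟩
    rw [hc (c + 1) (by lia), Nat.add_sub_cancel_left, pow_one] at this
    rw [Submodule.map_smul'']
    exact Submodule.smul_mono le_rfl inf_le_right this
  obtain ⟨z, hz, hzy⟩ := hy2
  have hzQ : z ∈ Q := by
    have : m • (⊤ : Submodule k L) ≤ Q.restrictScalars k :=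
      Submodule.smul_le.2 fun a ha l _ => IsPrimitiveIdeal.algebraMap_smul_mem ha l
    exact this hz
  have hyz : φ (y - z) ∈ I := by
    have : ψ (y - z) = 0 := by rw [map_sub, hzy, sub_self]
    exact (Submodule.Quotient.mk_eq_zero _).1 this
  exact hyQ (by simpa using Q.add_mem (hIQ _ hyz) hzQ)

end FiniteTypeMorphism

/-- Theorem: the bijection `φ*` induced by a spectrum preserving morphism is a
homeomorphism for the Jacobson topologies: a subset `C ⊆ Prim(J)` is closed (of the
form `V(S)`) iff its image `φ*(C) ⊆ Prim(L)` is closed. -/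
theorem induced_map_is_homeomorphism
    (k : Type) [CommRing k] [Algebra ℂ k] [Algebra.FiniteType ℂ k]
    (L J : Type) [Ring L] [Ring J] [Algebra k L] [Algebra k J]
    [Module.Finite k L] [Module.Finite k J]
    (φ : L →ₙₐ[k] J) (f : PrimSpec J → PrimSpec L) (hf : IsGraphOf φ f) :
    ∀ C : Set (PrimSpec J),
      (∃ S : Set J, C = {P : PrimSpec J | S ⊆ (P.1 : Set J)}) ↔
      (∃ S' : Set L, f '' C = {Q : PrimSpec L | S' ⊆ (Q.1 : Set L)}) := by
  have : IsNoetherianRing k := Algebra.FiniteType.isNoetherianRing ℂ k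
  obtain ⟨hbij, hgraph⟩ := hf
  have hfP (P : PrimSpec J) (x : L) (hx : φ x ∈ P.1) : x ∈ (f P).1 := (hgraph P _).2 rfl hx
  intro C
  constructor
  · rintro ⟨S, rfl⟩
    let I : Ideal J := sInf {P | IsPrimitiveIdeal J P ∧ S ⊆ P}
    have hI : ∀ i ∈ I, ∀ j : J, i * j ∈ I := fun i hi j =>
      Submodule.mem_sInf.2 fun P hP => hP.1.mul_mem_right (Submodule.mem_sInf.1 hi P hP) j
    refine ⟨{x | φ x ∈ I}, Set.Subset.antisymm ?_ fun Q hQ => ?_⟩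
    · rintro _ ⟨P, hP, rfl⟩ x hx
      exact hfP P x (Submodule.mem_sInf.1 hx P.1 ⟨P.2, hP⟩)
    · obtain ⟨P, hP, hIP, hPQ⟩ := exists_isPrimitiveIdeal_preimage_le φ hI Q.2 hQ
      refine ⟨⟨P, hP⟩, fun s hs => hIP ?_, (hgraph ⟨P, hP⟩ Q).1 hPQ⟩
      exact Submodule.mem_sInf.2 fun P' hP' => hP'.2 hs
  · rintro ⟨S, hS⟩
    let I : Ideal L := sInf {Q | IsPrimitiveIdeal L Q ∧ S ⊆ Q}
    obtain ⟨r, g, hg⟩ := Module.Finite.exists_fin (R := k) (M := J)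
    have hC (P : PrimSpec J) : P ∈ C ↔ I ≤ (f P).1 := by
      rw [← hbij.injective.mem_set_image, hS]
      refine ⟨fun h => sInf_le ⟨(f P).2, h⟩, fun h s hs => h ?_⟩
      exact Submodule.mem_sInf.2 fun Q hQ => hQ.2 hs
    refine ⟨φ '' ((fun N : Ideal L => I • N)^[r] ⊤ : Ideal L), Set.ext fun P => ?_⟩
    rw [hC]
    constructor
    · rintro h _ ⟨x, hx, rfl⟩
      refine map_mem_of_mem_iterate_smul φ g hg P.2 (fun Q hQ hPQ => ?_) hx
      rwa [(hgraph P ⟨Q, hQ⟩).1 hPQ] at h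
    · intro h
      exact (f P).2.le_of_iterate_smul_le r fun x hx => hfP P x (h ⟨x, hx, rfl⟩)
end

section
/- Let k be a finitely generated commutative ℂ-algebra, L and J unital finite type k-algebras, and φ: L → J a spectrum preserving k-linear algebra homomorphism. Then for every primitive ideal P of J, the image φ*(P) of P under the induced bijection φ*: Prim(J) → Prim(L) equals p⁻¹(Jac(L/φ⁻¹(P))), where p: L → L/φ⁻¹(P) is the canonical projection; that is, φ*(P) is the preimage in L of the Jacobson radical of L/φ⁻¹(P). -/
/-- Primitive ideals pull back to primitive ideals along surjective ring homomorphisms. -/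
theorem IsPrimitiveIdeal.comap_of_surjective {A B : Type} [Ring A] [Ring B] (g : A →+* B)
    (hg : Function.Surjective g) {I : Ideal B} (hI : IsPrimitiveIdeal B I) :
    IsPrimitiveIdeal A (I.comap g) := by
  obtain ⟨V, _, _, hV, rfl⟩ := hI
  let _ : Module A V := Module.compHom V g
  have : RingHomSurjective g := ⟨hg⟩
  let e : V →ₛₗ[g] V :=
    { toFun := id, map_add' := fun _ _ => rfl, map_smul' := fun _ _ => rfl }
  refine ⟨V, inferInstance, inferInstance,
    (e.isSimpleModule_iff_of_bijective Function.bijective_id).2 hV, ?_⟩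
  ext x
  rw [Ideal.mem_comap, Module.mem_annihilator, Module.mem_annihilator]
  rfl

/-- A primitive ideal containing the kernel of a surjective ring homomorphism is the
preimage of a primitive ideal. -/
theorem IsPrimitiveIdeal.exists_eq_comap_of_ker_le {A B : Type} [Ring A] [Ring B] (g : A →+* B)
    (hg : Function.Surjective g) {I : Ideal A} (hI : IsPrimitiveIdeal A I)
    (hker : ∀ x, g x = 0 → x ∈ I) :
    ∃ I' : Ideal B, IsPrimitiveIdeal B I' ∧ I = I'.comap g := by
  obtain ⟨V, _, _, hV, rfl⟩ := hI
  let lift : B →+* AddMonoid.End V := g.liftOfSurjective hg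
    ⟨Module.toAddMonoidEnd A V, fun x hx => by
      ext v
      exact Module.mem_annihilator.1 (hker x hx) v⟩
  have hlift (a : A) : lift (g a) = Module.toAddMonoidEnd A V a :=
    g.liftOfSurjective_comp_apply hg _ a
  let _ : Module B V := Module.compHom V lift
  have hsmul (a : A) (v : V) : g a • v = a • v := congrArg (fun F => F v) (hlift a)
  have : RingHomSurjective g := ⟨hg⟩
  let e : V →ₛₗ[g] V :=
    { toFun := id, map_add' := fun _ _ => rfl, map_smul' := fun a v => (hsmul a v).symm }
  refine ⟨Module.annihilator B V, ⟨V, inferInstance, inferInstance,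
    (e.isSimpleModule_iff_of_bijective Function.bijective_id).1 hV, rfl⟩, ?_⟩
  ext x
  simp only [Ideal.mem_comap, Module.mem_annihilator, hsmul]

/-- For a spectrum preserving `φ : L → J` with induced bijection `φ* = f`, and a
primitive ideal `P` of `J`, the primitive ideal `φ*(P)` of `L` is the preimage under
the projection `p : L → L/φ⁻¹(P)` of the Jacobson radical of `L/φ⁻¹(P)` (the quotient
being presented as a surjective image of `L` with kernel `φ⁻¹(P)`). -/
theorem induced_bijection_via_jacobson_radical
    (k : Type) [CommRing k] [Algebra ℂ k] [Algebra.FiniteType ℂ k]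
    (L J : Type) [Ring L] [Ring J] [Algebra k L] [Algebra k J]
    [Module.Finite k L] [Module.Finite k J]
    (φ : L →ₙₐ[k] J) (f : PrimSpec J → PrimSpec L) (hf : IsGraphOf φ f)
    (P : PrimSpec J)
    (L' : Type) [Ring L'] [Algebra k L'] (p : L →ₐ[k] L')
    (hp : Function.Surjective p)
    (hker : ∀ x : L, p x = 0 ↔ φ x ∈ P.1) :
    ((f P).1 : Set L) = ⇑p ⁻¹' (jacRad L' : Set L') := by
  ext x
  rw [Set.mem_preimage, SetLike.mem_coe, SetLike.mem_coe, jacRad, Submodule.mem_sInf]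
  refine ⟨fun hx I hI => ?_, fun hx => ?_⟩
  · have hQ : f P = ⟨_, hI.comap_of_surjective (p : L →+* L') hp⟩ :=
      (hf.2 P _).1 fun y hy => by
        change p y ∈ I
        rw [(hker y).2 hy]
        exact I.zero_mem
    rw [hQ] at hx
    exact hx
  · obtain ⟨I, hI, h⟩ := (f P).2.exists_eq_comap_of_ker_le (p : L →+* L') hp
      fun y hy => (hf.2 P (f P)).2 rfl ((hker y).1 hy)
    rw [h]
    exact hx I hI
end
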